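/- arXiv:1810.08679 — 2 statements merged into one kernel-verified Lean document; each statement's English description precedes it below -/
import Mathlib

section
/- The set Ā of primes satisfies limsup_{x→∞} |Ā_{≤x}| / (x/(log x)³) ≤ 24·𝔖_A. -/
/-- `Abar` is the set of primes `p` with `p ≡ 2 (mod 3)` such that there exist
`α, β, γ, μ, ν ≥ 1` and primes `q, r`, both coprime to `6`, with
`p + 1 = 2^α * 3^β * q^μ` and `p - 1 = 2^γ * r^ν`. -/
def Abar : Set ℕ :=
  {p | p.Prime ∧ p % 3 = 2 ∧ ∃ α β γ μ ν q r : ℕ,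
    1 ≤ α ∧ 1 ≤ β ∧ 1 ≤ γ ∧ 1 ≤ μ ∧ 1 ≤ ν ∧
    q.Prime ∧ r.Prime ∧ Nat.Coprime q 6 ∧ Nat.Coprime r 6 ∧
    p + 1 = 2 ^ α * 3 ^ β * q ^ μ ∧ p - 1 = 2 ^ γ * r ^ ν}

/-- The singular series constant `𝔖_A = 9 * ∏_{p ≥ 5 prime} (1 - 3/p) (1 - 1/p)⁻³`. -/
noncomputable def SA : ℝ :=
  9 * ∏' p : {p : ℕ // p.Prime ∧ 5 ≤ p},
    (1 - 3 / (p.1 : ℝ)) * ((1 - 1 / (p.1 : ℝ))⁻¹) ^ 3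

namespace AbarSieve
open Finset

/-- The product `(n - 1) n (n + 1)` for `n = 6 m + 5`. -/
def tripleProd (m : ℕ) : ℕ := (6 * m + 4) * (6 * m + 5) * (6 * m + 6)

theorem tripleProd_strictMono : StrictMono tripleProd := by
  intro a b h
  unfold tripleProd
  gcongr

/-- The number of residues `z` modulo `d` at which `tripleProd` vanishes. -/
noncomputable def rootCount (d : ℕ) : ℕ :=
  Nat.card {z : ZMod d // (6 * z + 4) * (6 * z + 5) * (6 * z + 6) = 0}

theorem rootCount_one : rootCount 1 = 1 := by
  unfold rootCount
  rw [Nat.card_eq_one_iff_unique]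
  exact ⟨⟨fun a b => Subtype.ext (Subsingleton.elim _ _)⟩, ⟨0, Subsingleton.elim _ _⟩⟩

theorem rootCount_mul {m n : ℕ} (h : m.Coprime n) :
    rootCount (m * n) = rootCount m * rootCount n := by
  unfold rootCount
  rw [← Nat.card_prod]
  let e := ZMod.chineseRemainder h
  refine Nat.card_congr (((Equiv.subtypeEquiv (p := fun z : ZMod (m * n) =>
    (6 * z + 4) * (6 * z + 5) * (6 * z + 6) = 0)
    (q := fun z : ZMod m × ZMod n => (6 * z.1 + 4) * (6 * z.1 + 5) * (6 * z.1 + 6) = 0 ∧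
      (6 * z.2 + 4) * (6 * z.2 + 5) * (6 * z.2 + 6) = 0) e.toEquiv) ?_).trans
      (Equiv.subtypeProdEquivProd
        (p := fun z : ZMod m => (6 * z + 4) * (6 * z + 5) * (6 * z + 6) = 0)
        (q := fun z : ZMod n => (6 * z + 4) * (6 * z + 5) * (6 * z + 6) = 0)))
  intro z
  have : (6 * z + 4) * (6 * z + 5) * (6 * z + 6) = 0 ↔
      (6 * e z + 4) * (6 * e z + 5) * (6 * e z + 6) = 0 := by
    have h6 : e 6 = 6 := map_ofNat e 6
    have h5 : e 5 = 5 := map_ofNat e 5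
    have h4 : e 4 = 4 := map_ofNat e 4
    rw [← map_eq_zero_iff e e.injective]
    simp only [map_mul, map_add, h6, h5, h4]
  rw [this, Prod.ext_iff]
  rfl

theorem rootCount_prime {p : ℕ} (hp : p.Prime) (h5 : 5 ≤ p) : rootCount p = 3 := by
  have := Fact.mk hp
  have h6 : (6 : ZMod p) ≠ 0 := by
    intro h
    have : ((6 : ℕ) : ZMod p) = 0 := by exact_mod_cast h
    rw [ZMod.natCast_eq_zero_iff] at this
    have := (Nat.Prime.dvd_mul hp (m := 2) (n := 3)).1 this
    rcases this with h | h <;> have := Nat.le_of_dvd (by norm_num) h <;> omega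
  have h2 : (2 : ZMod p) ≠ 0 := by
    intro h; apply h6; linear_combination 3 * h
  unfold rootCount
  have : {z : ZMod p | (6 * z + 4) * (6 * z + 5) * (6 * z + 6) = 0} =
      (({-4 / 6, -5 / 6, -6 / 6} : Finset (ZMod p)) : Set (ZMod p)) := by
    ext z
    simp only [Set.mem_ofPred_eq, mul_eq_zero, coe_insert, coe_singleton, Set.mem_insert_iff,
      Set.mem_singleton_iff, eq_div_iff h6, or_assoc, eq_neg_iff_add_eq_zero, mul_comm z]
  have h' := Nat.card_congr (Equiv.setCongr this)
  refine Eq.trans h' ?_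
  rw [Nat.card_coe_set_eq, Set.ncard_coe_finset, card_eq_three]
  refine ⟨_, _, _, ?_, ?_, ?_, rfl⟩
  all_goals
    rw [ne_eq, div_left_inj' h6]
    intro h
  · exact one_ne_zero (α := ZMod p) (by linear_combination h)
  · exact h2 (by linear_combination h)
  · exact one_ne_zero (α := ZMod p) (by linear_combination h)

theorem five_le_of_coprime_six {p : ℕ} (hp : p.Prime) (h : p.Coprime 6) : 5 ≤ p := by
  by_contra! hlt
  have := hp.two_le
  interval_cases p <;> revert h hp <;> decide

theorem rootCount_squarefree (d : ℕ) :
    Squarefree d → d.Coprime 6 → rootCount d = 3 ^ d.primeFactors.card := by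
  induction d using induction_on_primes with
  | zero => intro h; exact absurd h not_squarefree_zero
  | one => intro _ _; simp [rootCount_one]
  | prime_mul p a hp ih =>
    intro hs hc
    rw [Nat.squarefree_mul_iff] at hs
    rw [rootCount_mul hs.1, ih hs.2.2 (Nat.Coprime.coprime_mul_left hc),
      rootCount_prime hp (five_le_of_coprime_six hp (Nat.Coprime.coprime_mul_right hc)),
      hs.1.primeFactors_mul, card_union_of_disjoint hs.1.disjoint_primeFactors,
      hp.primeFactors, card_singleton, pow_add, pow_one]

theorem abs_card_tripleProd_sub_le {d : ℕ} (hs : Squarefree d) (hc : d.Coprime 6) (M : ℕ) :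
    |(((range M).filter fun m => d ∣ tripleProd m).card : ℝ)
      - 3 ^ d.primeFactors.card / d * M| ≤ 3 ^ d.primeFactors.card := by
  classical
  have hd : 0 < d := Nat.pos_of_ne_zero hs.ne_zero
  have : NeZero d := ⟨hd.ne'⟩
  let T : Finset (ZMod d) := univ.filter fun z => (6 * z + 4) * (6 * z + 5) * (6 * z + 6) = 0
  have hT : T.card = 3 ^ d.primeFactors.card := by
    rw [← rootCount_squarefree d hs hc, rootCount, Nat.card_eq_fintype_card,
      Fintype.card_subtype]
  have hmem : ∀ m : ℕ, d ∣ tripleProd m ↔ (m : ZMod d) ∈ T := by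
    intro m
    simp only [T, mem_filter, mem_univ, true_and]
    rw [← ZMod.natCast_eq_zero_iff]
    simp [tripleProd]
  have hcard : ((range M).filter fun m => d ∣ tripleProd m).card =
      ∑ z ∈ T, ((range M).filter fun m : ℕ => (m : ZMod d) = z).card := by
    rw [card_eq_sum_card_fiberwise (f := fun m : ℕ => (m : ZMod d)) (t := T)]
    · refine sum_congr rfl fun z hz => ?_
      congr 1
      ext m
      simp only [mem_filter, hmem]
      constructor
      · rintro ⟨⟨h1, h2⟩, h3⟩; exact ⟨h1, h3⟩
      · rintro ⟨h1, h3⟩; exact ⟨⟨h1, h3 ▸ hz⟩, h3⟩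
    · intro m hm
      simp only [coe_filter, Set.mem_ofPred_eq, hmem] at hm
      exact hm.2
  have hz : ∀ z ∈ T, |(((range M).filter fun m : ℕ => (m : ZMod d) = z).card : ℝ) - M / d| ≤ 1 := by
    intro z _
    have h1 : ((range M).filter fun m : ℕ => (m : ZMod d) = z).card =
        M / d + if z.val % d < M % d then 1 else 0 := by
      rw [← Nat.count_modEq_card M hd, Nat.count_eq_card_filter_range]
      congr 1
      ext m
      simp only [mem_filter, ← ZMod.natCast_eq_natCast_iff, ZMod.natCast_zmod_val]
    have h2 : (M : ℝ) / d = (M / d : ℕ) + (M % d : ℕ) / (d : ℝ) := by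
      have hd' : (d : ℝ) ≠ 0 := by positivity
      field_simp
      exact_mod_cast (Nat.div_add_mod M d).symm
    have h3 : ((M % d : ℕ) : ℝ) / d ≤ 1 := by
      rw [div_le_one (by positivity)]
      exact_mod_cast (Nat.mod_lt M hd).le
    have h4 : 0 ≤ ((M % d : ℕ) : ℝ) / d := by positivity
    rw [h1, h2, abs_le]
    split_ifs <;> push_cast <;> constructor <;> linarith
  rw [hcard]
  push_cast
  have hcT : (3 : ℝ) ^ d.primeFactors.card = T.card := by rw [hT]; push_cast; rfl
  calc _ = |∑ z ∈ T, ((((range M).filter fun m : ℕ => (m : ZMod d) = z).card : ℝ) - M / d)| := by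
        rw [sum_sub_distrib, sum_const, nsmul_eq_mul, hcT]
        congr 2; ring
    _ ≤ ∑ z ∈ T, 1 := (abs_sum_le_sum_abs _ _).trans (sum_le_sum hz)
    _ = _ := by rw [hcT]; simp

end AbarSieve

namespace AbarSieve
open Finset Nat ArithmeticFunction BoundingSieve
open scoped ArithmeticFunction.Moebius

variable (s : BoundingSieve) (R : ℕ)

/-- The sum `∑ g(l)` of Selberg terms over `l ∣ P` with `l ≤ R`. -/
noncomputable def selbergSum : ℝ := ∑ l ∈ s.prodPrimes.divisors with l ≤ R, s.selbergTerms l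

/-- The optimal `Λ²` weights of level `R`. -/
noncomputable def selbergWeight (d : ℕ) : ℝ :=
  (s.nu d)⁻¹ * μ d * (selbergSum s R)⁻¹ *
    ∑ k ∈ s.prodPrimes.divisors with d ∣ k ∧ k ≤ R, s.selbergTerms k

variable {s R}

theorem selbergSum_pos (hR : 1 ≤ R) : 0 < selbergSum s R := by
  refine sum_pos (fun l hl => selbergTerms_pos ?_) ⟨1, ?_⟩
  · exact Nat.dvd_of_mem_divisors (mem_filter.1 hl).1
  · simp [hR, prodPrimes_ne_zero]

theorem sum_moebius_between {l k : ℕ} (hk : k ∣ s.prodPrimes) (hl : l ∣ s.prodPrimes) :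
    ∑ d ∈ s.prodPrimes.divisors with l ∣ d ∧ d ∣ k, μ d = if k = l then μ l else 0 := by
  by_cases hlk : l ∣ k
  · obtain ⟨m, rfl⟩ := hlk
    have hsq := squarefree_of_dvd_prodPrimes hk
    have hlm : l * m ≠ 0 := hsq.ne_zero
    have hl0 : 0 < l := Nat.pos_of_ne_zero (left_ne_zero_of_mul hlm)
    have hset : {d ∈ s.prodPrimes.divisors | l ∣ d ∧ d ∣ l * m} =
        m.divisors.image (l * ·) := by
      ext d
      simp only [mem_filter, mem_divisors, mem_image]
      constructor
      · rintro ⟨-, ⟨e, rfl⟩, h⟩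
        exact ⟨e, ⟨Nat.dvd_of_mul_dvd_mul_left hl0 h, right_ne_zero_of_mul hlm⟩, rfl⟩
      · rintro ⟨e, ⟨he, -⟩, rfl⟩
        have := Nat.mul_dvd_mul_left l he
        exact ⟨⟨this.trans hk, prodPrimes_ne_zero⟩, dvd_mul_right _ _, this⟩
    rw [hset, sum_image (fun a _ b _ h => Nat.eq_of_mul_eq_mul_left hl0 h)]
    have : ∀ e ∈ m.divisors, μ (l * e) = μ l * μ e := by
      intro e he
      refine isMultiplicative_moebius.map_mul_of_coprime ?_
      exact (coprime_of_squarefree_mul hsq).coprime_dvd_right (dvd_of_mem_divisors he)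
    rw [sum_congr rfl this, ← mul_sum, ← coe_mul_zeta_apply, moebius_mul_coe_zeta, one_apply]
    by_cases hm : m = 1
    · simp [hm]
    · rw [if_neg hm, if_neg, mul_zero]
      intro h
      exact hm (Nat.eq_of_mul_eq_mul_left hl0 (by rw [h, mul_one]))
  · rw [if_neg (by rintro rfl; exact hlk dvd_rfl), filter_false_of_mem, sum_empty]
    rintro d - ⟨h1, h2⟩
    exact hlk (h1.trans h2)

theorem selbergWeight_one (hR : 1 ≤ R) : selbergWeight s R 1 = 1 := by
  have h := (selbergSum_pos (s := s) hR).ne'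
  simp only [selbergWeight, one_dvd, true_and]
  rw [s.nu_mult.map_one]
  simp only [isMultiplicative_moebius.map_one, Int.cast_one, inv_one, one_mul]
  exact inv_mul_cancel₀ h

theorem sum_nu_mul_selbergWeight {l : ℕ} (hl : l ∣ s.prodPrimes) :
    (∑ d ∈ s.prodPrimes.divisors, if l ∣ d then s.nu d * selbergWeight s R d else 0) =
      if l ≤ R then (selbergSum s R)⁻¹ * μ l * s.selbergTerms l else 0 := by
  have h1 : ∀ d ∈ s.prodPrimes.divisors, (if l ∣ d then s.nu d * selbergWeight s R d else 0) =
      ∑ k ∈ s.prodPrimes.divisors with k ≤ R, if l ∣ d ∧ d ∣ k then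
        (selbergSum s R)⁻¹ * s.selbergTerms k * μ d else 0 := by
    intro d hd
    have hn : s.nu d ≠ 0 := nu_ne_zero (dvd_of_mem_divisors hd)
    split_ifs with hld
    · simp only [hld, true_and]
      rw [selbergWeight, ← sum_filter, filter_filter]
      simp only [and_comm (a := d ∣ _)]
      rw [← mul_assoc, mul_sum]
      refine sum_congr rfl fun k _ => ?_
      field_simp
    · simp [hld]
  rw [sum_congr rfl h1, sum_comm]
  have h2 : ∀ k ∈ {k ∈ s.prodPrimes.divisors | k ≤ R},
      (∑ d ∈ s.prodPrimes.divisors, if l ∣ d ∧ d ∣ k then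
        (selbergSum s R)⁻¹ * s.selbergTerms k * μ d else 0) =
      if k = l then (selbergSum s R)⁻¹ * μ l * s.selbergTerms l else 0 := by
    intro k hk
    have hk' := dvd_of_mem_divisors (mem_filter.1 hk).1
    have := sum_moebius_between hk' hl
    rw [← sum_filter, ← mul_sum, ← Int.cast_sum, this]
    split_ifs with h
    · subst h; ring
    · simp
  rw [sum_congr rfl h2, sum_ite_eq']
  simp [hl, prodPrimes_ne_zero]

theorem mainSum_selbergWeight (hR : 1 ≤ R) :
    s.mainSum (lambdaSquared (selbergWeight s R)) = (selbergSum s R)⁻¹ := by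
  have h := (selbergSum_pos (s := s) hR).ne'
  rw [mainSum_lambdaSquared_eq_sum_mul_sum_sq]
  have h1 : ∀ l ∈ s.prodPrimes.divisors, (s.selbergTerms l)⁻¹ *
      (∑ d ∈ s.prodPrimes.divisors, if l ∣ d then s.nu d * selbergWeight s R d else 0) ^ 2 =
      if l ≤ R then (selbergSum s R)⁻¹ ^ 2 * s.selbergTerms l else 0 := by
    intro l hl
    have hl' := dvd_of_mem_divisors hl
    have hg := (selbergTerms_pos hl').ne'
    rw [sum_nu_mul_selbergWeight hl']
    split_ifs with hlR
    · have hmu : (μ l : ℝ) ^ 2 = 1 := by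
        exact_mod_cast moebius_sq_eq_one_of_squarefree (squarefree_of_dvd_prodPrimes hl')
      rw [mul_pow, mul_pow, hmu]
      field_simp
    · simp
  rw [sum_congr rfl h1, ← sum_filter, ← mul_sum]
  change (selbergSum s R)⁻¹ ^ 2 * selbergSum s R = _
  field_simp

theorem abs_selbergWeight_le (hR : 1 ≤ R) {d : ℕ} (hd : d ∣ s.prodPrimes) :
    |selbergWeight s R d| ≤ if d ≤ R then ∏ p ∈ d.primeFactors, (1 - s.nu p)⁻¹ else 0 := by
  have hS := selbergSum_pos (s := s) hR
  have hd0 : 0 < d := Nat.pos_of_ne_zero (squarefree_of_dvd_prodPrimes hd).ne_zero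
  have hnu := nu_pos_of_dvd_prodPrimes hd
  have hmu : |(μ d : ℝ)| = 1 := by
    have : |μ d| = 1 := abs_moebius_eq_one_of_squarefree (squarefree_of_dvd_prodPrimes hd)
    exact_mod_cast this
  have hg0 : 0 ≤ ∑ k ∈ s.prodPrimes.divisors with d ∣ k ∧ k ≤ R, s.selbergTerms k :=
    sum_nonneg fun k hk => (selbergTerms_pos (dvd_of_mem_divisors (mem_filter.1 hk).1)).le
  have habs : |selbergWeight s R d| = (s.nu d)⁻¹ * (selbergSum s R)⁻¹ *
      ∑ k ∈ s.prodPrimes.divisors with d ∣ k ∧ k ≤ R, s.selbergTerms k := by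
    rw [selbergWeight, abs_mul, abs_mul, abs_mul, hmu, abs_of_nonneg hg0,
      abs_of_pos (inv_pos.2 hnu), abs_of_pos (inv_pos.2 hS), mul_one]
  rw [habs]
  split_ifs with hdR
  · have hsum : ∑ k ∈ s.prodPrimes.divisors with d ∣ k ∧ k ≤ R, s.selbergTerms k ≤
        s.selbergTerms d * selbergSum s R := by
      have : ∀ k ∈ {k ∈ s.prodPrimes.divisors | d ∣ k ∧ k ≤ R},
          s.selbergTerms k = s.selbergTerms d * s.selbergTerms (k / d) := by
        intro k hk
        simp only [mem_filter, mem_divisors] at hk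
        obtain ⟨⟨hk, -⟩, ⟨m, rfl⟩, -⟩ := hk
        rw [Nat.mul_div_cancel_left _ hd0]
        exact selbergTerms_isMultiplicative.map_mul_of_coprime
          (coprime_of_squarefree_mul (squarefree_of_dvd_prodPrimes hk))
      rw [sum_congr rfl this, ← mul_sum]
      refine mul_le_mul_of_nonneg_left ?_ (selbergTerms_pos hd).le
      rw [← sum_image (g := fun k => k / d) (f := fun k => s.selbergTerms k)]
      · refine sum_le_sum_of_subset_of_nonneg ?_ ?_
        · intro m hm
          simp only [mem_image, mem_filter, mem_divisors] at hm ⊢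
          obtain ⟨k, ⟨⟨hk, h0⟩, hdk, hkR⟩, rfl⟩ := hm
          exact ⟨⟨(Nat.div_dvd_of_dvd hdk).trans hk, h0⟩, (Nat.div_le_self _ _).trans hkR⟩
        · intro k hk _
          exact (selbergTerms_pos (dvd_of_mem_divisors (mem_filter.1 hk).1)).le
      · intro a ha b hb hab
        simp only [coe_filter, Set.mem_ofPred_eq] at ha hb
        have hab' : a / d = b / d := hab
        rw [← Nat.mul_div_cancel' ha.2.1, ← Nat.mul_div_cancel' hb.2.1, hab']
    calc _ ≤ (s.nu d)⁻¹ * (selbergSum s R)⁻¹ * (s.selbergTerms d * selbergSum s R) := by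
          gcongr
      _ = _ := by
          rw [selbergTerms_apply]
          field_simp
  · rw [filter_false_of_mem, sum_empty, mul_zero]
    rintro k hk ⟨h1, h2⟩
    have hk0 : 0 < k := Nat.pos_of_mem_divisors hk
    exact hdR ((Nat.le_of_dvd hk0 h1).trans h2)

theorem errSum_lambdaSquared_le (w : ℕ → ℝ) :
    s.errSum (lambdaSquared w) ≤
      ∑ d1 ∈ s.prodPrimes.divisors, ∑ d2 ∈ s.prodPrimes.divisors,
        |w d1| * |w d2| * |s.rem (d1.lcm d2)| := by
  have h1 : ∀ d ∈ s.prodPrimes.divisors, |lambdaSquared w d| * |s.rem d| ≤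
      ∑ d1 ∈ s.prodPrimes.divisors, ∑ d2 ∈ s.prodPrimes.divisors,
        if d = d1.lcm d2 then |w d1| * |w d2| * |s.rem d| else 0 := by
    intro d hd
    have hd' := dvd_of_mem_divisors hd
    have hsub : d.divisors ⊆ s.prodPrimes.divisors :=
      Nat.divisors_subset_of_dvd prodPrimes_ne_zero hd'
    calc |lambdaSquared w d| * |s.rem d|
        ≤ (∑ d1 ∈ d.divisors, ∑ d2 ∈ d.divisors,
          if d = d1.lcm d2 then |w d1| * |w d2| else 0) * |s.rem d| := by
          refine mul_le_mul_of_nonneg_right ?_ (abs_nonneg _)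
          refine (abs_sum_le_sum_abs _ _).trans (sum_le_sum fun d1 _ => ?_)
          refine (abs_sum_le_sum_abs _ _).trans (sum_le_sum fun d2 _ => ?_)
          split_ifs <;> simp [abs_mul]
      _ = ∑ d1 ∈ d.divisors, ∑ d2 ∈ d.divisors,
          if d = d1.lcm d2 then |w d1| * |w d2| * |s.rem d| else 0 := by
          simp only [sum_mul, ite_mul, zero_mul]
      _ ≤ _ := by
          refine (sum_le_sum fun d1 _ => sum_le_sum_of_subset_of_nonneg hsub ?_).trans
            (sum_le_sum_of_subset_of_nonneg hsub ?_)
          · intros; split_ifs <;> positivity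
          · intros; refine sum_nonneg fun _ _ => ?_; split_ifs <;> positivity
  refine (sum_le_sum h1).trans ?_
  rw [sum_comm]
  refine sum_le_sum fun d1 hd1 => ?_
  rw [sum_comm]
  refine sum_le_sum fun d2 hd2 => ?_
  rw [sum_ite_eq']
  split_ifs
  · exact le_rfl
  · positivity

/-- The Selberg upper bound sieve. -/
theorem siftedSum_le_selberg (hR : 1 ≤ R) (B : ℕ → ℝ) (E : ℕ → ℝ)
    (hB : ∀ d, d ∣ s.prodPrimes → ∏ p ∈ d.primeFactors, (1 - s.nu p)⁻¹ ≤ B d)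
    (hE : ∀ d1, d1 ∣ s.prodPrimes → ∀ d2, d2 ∣ s.prodPrimes →
      |s.rem (d1.lcm d2)| ≤ E d1 * E d2) :
    s.siftedSum ≤ s.totalMass / selbergSum s R +
      (∑ d ∈ s.prodPrimes.divisors with d ≤ R, B d * E d) ^ 2 := by
  have h := siftedSum_le_mainSum_errSum_of_upperMoebius (s := s) _
    (upperMoebius_lambdaSquared (selbergWeight s R) (selbergWeight_one hR))
  rw [mainSum_selbergWeight hR, ← div_eq_mul_inv] at h
  refine h.trans (add_le_add le_rfl ((errSum_lambdaSquared_le _).trans ?_))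
  rw [sq, sum_mul_sum, sum_filter]
  refine sum_le_sum fun d1 hd1 => ?_
  have hw1 := abs_selbergWeight_le hR (dvd_of_mem_divisors hd1)
  have hB1 := hB d1 (dvd_of_mem_divisors hd1)
  split_ifs with h1
  · rw [if_pos h1] at hw1
    rw [sum_filter]
    refine sum_le_sum fun d2 hd2 => ?_
    have hw2 := abs_selbergWeight_le hR (dvd_of_mem_divisors hd2)
    have hB2 := hB d2 (dvd_of_mem_divisors hd2)
    split_ifs with h2
    · rw [if_pos h2] at hw2
      have hrem := hE d1 (dvd_of_mem_divisors hd1) d2 (dvd_of_mem_divisors hd2)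
      have b1 := hw1.trans hB1
      have b2 := hw2.trans hB2
      have c1 := (abs_nonneg _).trans b1
      have c2 := (abs_nonneg _).trans b2
      calc _ ≤ B d1 * B d2 * (E d1 * E d2) := by gcongr
        _ = _ := by ring
    · rw [if_neg h2] at hw2
      rw [le_antisymm hw2 (abs_nonneg _)]; simp
  · rw [if_neg h1] at hw1
    rw [le_antisymm hw1 (abs_nonneg _)]; simp

end AbarSieve

namespace AbarSieve
open Finset Nat ArithmeticFunction BoundingSieve

/-- The product of the primes `5 ≤ p ≤ R`. -/
def primeProd (R : ℕ) : ℕ := ∏ p ∈ range (R + 1) with p.Prime ∧ 5 ≤ p, p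

theorem primeFactors_primeProd (R : ℕ) :
    (primeProd R).primeFactors = {p ∈ range (R + 1) | p.Prime ∧ 5 ≤ p} :=
  Nat.primeFactors_prod fun _ hp => (mem_filter.1 hp).2.1

theorem squarefree_primeProd (R : ℕ) : Squarefree (primeProd R) := by
  refine Finset.squarefree_prod_of_pairwise_isCoprime (f := fun p : ℕ => p) ?_ ?_
  · intro p hp q hq hpq
    simp only [coe_filter, Set.mem_ofPred_eq] at hp hq
    exact Nat.coprime_iff_isRelPrime.1 ((Nat.coprime_primes hp.2.1 hq.2.1).2 hpq)
  · intro p hp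
    exact (mem_filter.1 hp).2.1.prime.squarefree

theorem prime_dvd_primeProd {R p : ℕ} (hp : p.Prime) : p ∣ primeProd R ↔ p ≤ R ∧ 5 ≤ p := by
  have h := primeFactors_primeProd R
  have h0 := (squarefree_primeProd R).ne_zero
  have : p ∈ (primeProd R).primeFactors ↔ p ∣ primeProd R := by
    simp [hp, h0]
  rw [← this, h]
  simp [hp]

theorem coprime_six_of_dvd_primeProd {R d : ℕ} (hd : d ∣ primeProd R) : d.Coprime 6 := by
  refine Nat.Coprime.coprime_dvd_left hd (Nat.Coprime.symm ?_)
  change (2 * 3).Coprime (primeProd R)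
  refine Nat.Coprime.mul_left ?_ ?_
  · rw [Nat.prime_two.coprime_iff_not_dvd, prime_dvd_primeProd Nat.prime_two]; omega
  · rw [Nat.prime_three.coprime_iff_not_dvd, prime_dvd_primeProd Nat.prime_three]; omega

theorem dvd_primeProd {R d : ℕ} (hs : Squarefree d) (hc : d.Coprime 6) (hd : d ≤ R) :
    d ∣ primeProd R := by
  rw [← Nat.prod_primeFactors_of_squarefree hs]
  refine prod_dvd_prod_of_subset _ _ _ fun p hp => ?_
  have hp' := Nat.prime_of_mem_primeFactors hp
  have hle := Nat.le_of_mem_primeFactors hp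
  simp only [mem_filter, mem_range, hp', true_and]
  exact ⟨by omega, five_le_of_coprime_six hp' (hc.coprime_dvd_left (dvd_of_mem_primeFactors hp))⟩

/-- The sieve problem of removing from `tripleProd m`, `m < M`, the multiples of the primes
`5 ≤ p ≤ R`. -/
noncomputable def tripleSieve (M R : ℕ) : BoundingSieve where
  support := (range M).image tripleProd
  prodPrimes := primeProd R
  prodPrimes_squarefree := squarefree_primeProd R
  weights := fun _ => 1
  weights_nonneg := fun _ => zero_le_one
  totalMass := M
  nu := prodPrimeFactors fun p => 3 / (p : ℝ)
  nu_mult := IsMultiplicative.prodPrimeFactors _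
  nu_pos_of_prime := by
    intro p hp _
    have := hp.pos
    rw [prodPrimeFactors_apply hp.ne_zero, hp.primeFactors, prod_singleton]
    positivity
  nu_lt_one_of_prime := by
    intro p hp h
    have h5 : (5 : ℝ) ≤ p := by exact_mod_cast ((prime_dvd_primeProd hp).1 h).2
    rw [prodPrimeFactors_apply hp.ne_zero, hp.primeFactors, prod_singleton,
      div_lt_one (by linarith)]
    linarith

theorem tripleSieve_nu_prime (M R : ℕ) {p : ℕ} (hp : p.Prime) :
    (tripleSieve M R).nu p = 3 / p := by
  simp only [tripleSieve]
  rw [prodPrimeFactors_apply hp.ne_zero, hp.primeFactors, prod_singleton]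

theorem tripleSieve_nu (M R : ℕ) {d : ℕ} (hd : Squarefree d) :
    (tripleSieve M R).nu d = 3 ^ d.primeFactors.card / d := by
  simp only [tripleSieve]
  rw [prodPrimeFactors_apply hd.ne_zero, prod_div_distrib, prod_const]
  rw [← Nat.cast_prod, Nat.prod_primeFactors_of_squarefree hd]

theorem tripleSieve_selbergTerms (M R : ℕ) {d : ℕ} (hd : d ∣ primeProd R) :
    (tripleSieve M R).selbergTerms d = ∏ p ∈ d.primeFactors, 3 / ((p : ℝ) - 3) := by
  rw [selbergTerms_apply, ← prod_primeFactors_nu (s := tripleSieve M R) hd, ← prod_mul_distrib]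
  refine prod_congr rfl fun p hp => ?_
  have hp' := Nat.prime_of_mem_primeFactors hp
  have h5 : (5 : ℝ) ≤ p := by
    exact_mod_cast ((prime_dvd_primeProd hp').1 ((dvd_of_mem_primeFactors hp).trans hd)).2
  rw [tripleSieve_nu_prime M R hp']
  have h1 : (p : ℝ) - 3 ≠ 0 := by linarith
  have h2 : (p : ℝ) ≠ 0 := by linarith
  have h3 : 1 - 3 / (p : ℝ) = (p - 3) / p := by field_simp
  rw [h3]
  field_simp

/-- The sum of `∏_{p ∣ d} 3 / (p - 3)` over squarefree `d ≤ R` coprime to `6`. -/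
noncomputable def mainDenominator (R : ℕ) : ℝ :=
  ∑ d ∈ (primeProd R).divisors with d ≤ R, ∏ p ∈ d.primeFactors, 3 / ((p : ℝ) - 3)

theorem selbergSum_tripleSieve (M R : ℕ) : selbergSum (tripleSieve M R) R = mainDenominator R := by
  refine sum_congr rfl fun d hd => ?_
  exact tripleSieve_selbergTerms M R (dvd_of_mem_divisors (mem_filter.1 hd).1)

theorem card_primeFactors_lcm_le {a b : ℕ} (ha : a ≠ 0) (hb : b ≠ 0) :
    (a.lcm b).primeFactors.card ≤ a.primeFactors.card + b.primeFactors.card := by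
  refine le_trans (card_le_card ?_) (card_union_le _ _)
  rw [← Nat.primeFactors_mul ha hb]
  exact Nat.primeFactors_mono (Nat.lcm_dvd_mul a b) (mul_ne_zero ha hb)

theorem card_coprime_tripleProd_le (M : ℕ) {R : ℕ} (hR : 1 ≤ R) :
    (((range M).filter fun m => (primeProd R).Coprime (tripleProd m)).card : ℝ) ≤
      M / mainDenominator R +
        (∑ d ∈ (primeProd R).divisors with d ≤ R, (9 : ℝ) ^ d.primeFactors.card) ^ 2 := by
  have h := siftedSum_le_selberg (s := tripleSieve M R) hR (fun d => 3 ^ d.primeFactors.card)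
    (fun d => 3 ^ d.primeFactors.card) ?_ ?_
  · rw [selbergSum_tripleSieve] at h
    simp only [← mul_pow] at h
    norm_num at h
    refine le_trans (le_of_eq ?_) h
    simp only [siftedSum, tripleSieve]
    rw [sum_image tripleProd_strictMono.injective.injOn, card_filter]
    push_cast
    rfl
  · intro d hd
    rw [← prod_const]
    refine prod_le_prod (fun p hp => ?_) (fun p hp => ?_) <;>
    · have hp' := Nat.prime_of_mem_primeFactors hp
      have h5 : (5 : ℝ) ≤ p := by
        exact_mod_cast ((prime_dvd_primeProd hp').1 ((dvd_of_mem_primeFactors hp).trans hd)).2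
      have h3 : 3 / (p : ℝ) ≤ 3 / 5 := by gcongr
      rw [tripleSieve_nu_prime M R hp']
      first
      | exact inv_nonneg.2 (by linarith)
      | exact inv_le_of_inv_le₀ (by norm_num) (by linarith)
  · intro d1 h1 d2 h2
    have hlcm : d1.lcm d2 ∣ primeProd R := Nat.lcm_dvd h1 h2
    have hsq := (squarefree_primeProd R).squarefree_of_dvd hlcm
    have hne : ∀ d, d ∣ primeProd R → d ≠ 0 := fun d hd =>
      ((squarefree_primeProd R).squarefree_of_dvd hd).ne_zero
    have hrem : (tripleSieve M R).rem (d1.lcm d2) =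
        (((range M).filter fun m => d1.lcm d2 ∣ tripleProd m).card : ℝ)
          - 3 ^ (d1.lcm d2).primeFactors.card / (d1.lcm d2 : ℕ) * M := by
      rw [rem, tripleSieve_nu M R hsq, multSum]
      simp only [tripleSieve]
      rw [sum_image tripleProd_strictMono.injective.injOn, card_filter]
      push_cast
      rfl
    rw [hrem]
    refine (abs_card_tripleProd_sub_le hsq (coprime_six_of_dvd_primeProd hlcm) M).trans ?_
    rw [← pow_add]
    exact pow_le_pow_right₀ (by norm_num) (card_primeFactors_lcm_le (hne _ h1) (hne _ h2))

theorem exists_nine_pow_card_primeFactors_le {ε : ℝ} (hε : 0 < ε) :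
    ∃ C : ℝ, 0 < C ∧ ∀ d : ℕ, Squarefree d → (9 : ℝ) ^ d.primeFactors.card ≤ C * (d : ℝ) ^ ε := by
  obtain ⟨K, hK⟩ := exists_nat_ge ((9 : ℝ) ^ (1 / ε))
  have hK9 : ∀ p : ℕ, K ≤ p → (9 : ℝ) ≤ (p : ℝ) ^ ε := by
    intro p hp
    have h1 : (9 : ℝ) ^ (1 / ε) ≤ p := hK.trans (by exact_mod_cast hp)
    calc (9 : ℝ) = ((9 : ℝ) ^ (1 / ε)) ^ ε := by
          rw [← Real.rpow_mul (by norm_num), one_div_mul_cancel hε.ne', Real.rpow_one]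
      _ ≤ _ := by gcongr
  refine ⟨9 ^ K, by positivity, fun d hd => ?_⟩
  have h1 : ∀ p ∈ d.primeFactors, (9 : ℝ) ≤ (if p < K then 9 else 1) * (p : ℝ) ^ ε := by
    intro p hp
    have hp1 : (1 : ℝ) ≤ p := by exact_mod_cast (Nat.prime_of_mem_primeFactors hp).one_le
    split_ifs with h
    · have := Real.one_le_rpow hp1 hε.le
      linarith
    · rw [one_mul]; exact hK9 p (by omega)
  calc (9 : ℝ) ^ d.primeFactors.card = ∏ p ∈ d.primeFactors, 9 := by rw [prod_const]
    _ ≤ ∏ p ∈ d.primeFactors, ((if p < K then 9 else 1) * (p : ℝ) ^ ε) :=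
        prod_le_prod (fun _ _ => by norm_num) h1
    _ = (∏ p ∈ d.primeFactors, if p < K then 9 else 1) * (d : ℝ) ^ ε := by
        rw [prod_mul_distrib, Real.finsetProd_rpow _ _ (fun p _ => by positivity),
          ← Nat.cast_prod, Nat.prod_primeFactors_of_squarefree hd]
    _ ≤ 9 ^ K * (d : ℝ) ^ ε := by
        refine mul_le_mul_of_nonneg_right ?_ (by positivity)
        rw [← prod_filter, prod_const]
        refine pow_le_pow_right₀ (by norm_num) ?_
        calc _ ≤ (range K).card := card_le_card fun p hp => by
              simp only [mem_filter] at hp; simpa using hp.2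
          _ = K := card_range K

theorem exists_sum_nine_pow_le {ε : ℝ} (hε : 0 < ε) :
    ∃ C : ℝ, 0 < C ∧ ∀ R : ℕ,
      ∑ d ∈ (primeProd R).divisors with d ≤ R, (9 : ℝ) ^ d.primeFactors.card ≤
        C * (R : ℝ) ^ (1 + ε) := by
  obtain ⟨C, hC, h⟩ := exists_nine_pow_card_primeFactors_le hε
  refine ⟨C, hC, fun R => ?_⟩
  rcases Nat.eq_zero_or_pos R with rfl | hR
  · rw [filter_false_of_mem, sum_empty]
    · positivity
    · intro d hd
      have := Nat.pos_of_mem_divisors hd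
      omega
  calc _ ≤ ∑ d ∈ (primeProd R).divisors with d ≤ R, C * (R : ℝ) ^ ε := by
        refine sum_le_sum fun d hd => ?_
        have hd' := mem_filter.1 hd
        refine (h d ((squarefree_primeProd R).squarefree_of_dvd
          (dvd_of_mem_divisors hd'.1))).trans ?_
        have : (d : ℝ) ≤ R := by exact_mod_cast hd'.2
        gcongr
    _ ≤ R * (C * (R : ℝ) ^ ε) := by
        rw [sum_const, nsmul_eq_mul]
        refine mul_le_mul_of_nonneg_right ?_ (by positivity)
        have : #{d ∈ (primeProd R).divisors | d ≤ R} ≤ #(Icc 1 R) := card_le_card fun d hd => by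
          have hd' := mem_filter.1 hd
          exact mem_Icc.2 ⟨Nat.pos_of_mem_divisors hd'.1, hd'.2⟩
        rw [Nat.card_Icc, Nat.add_sub_cancel] at this
        exact_mod_cast this
    _ = C * (R : ℝ) ^ (1 + ε) := by
        rw [Real.rpow_add (by exact_mod_cast hR), Real.rpow_one]; ring

end AbarSieve

namespace AbarSieve
open Finset Nat ArithmeticFunction
open scoped ArithmeticFunction.Omega

theorem sum_divisors_pow_cardFactors_le (k n : ℕ) :
    ∑ a ∈ n.divisors, k ^ Ω a ≤ (k + 1) ^ Ω n := by
  induction n using induction_on_primes with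
  | zero => simp
  | one => simp
  | prime_mul p n hp ih =>
    rcases Nat.eq_zero_or_pos n with rfl | hn
    · simp
    have hsub : (p * n).divisors ⊆ n.divisors ∪ n.divisors.image (p * ·) := by
      intro a ha
      rw [Nat.divisors_mul, hp.divisors, Finset.mem_mul] at ha
      obtain ⟨x, hx, y, hy, rfl⟩ := ha
      rw [mem_insert, mem_singleton] at hx
      rcases hx with rfl | rfl
      · simp [mem_union, hy]
      · exact mem_union_right _ (mem_image_of_mem _ hy)
    calc ∑ a ∈ (p * n).divisors, k ^ Ω a
        ≤ ∑ a ∈ n.divisors ∪ n.divisors.image (p * ·), k ^ Ω a :=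
          sum_le_sum_of_subset hsub
      _ ≤ ∑ a ∈ n.divisors, k ^ Ω a + ∑ a ∈ n.divisors.image (p * ·), k ^ Ω a := by
          rw [← sum_union_inter]; exact Nat.le_add_right _ _
      _ = ∑ a ∈ n.divisors, k ^ Ω a + k * ∑ a ∈ n.divisors, k ^ Ω a := by
          rw [sum_image (fun a _ b _ h => Nat.eq_of_mul_eq_mul_left hp.pos h), mul_sum]
          congr 1
          refine sum_congr rfl fun a ha => ?_
          rw [cardFactors_mul hp.ne_zero (Nat.pos_of_mem_divisors ha).ne',
            cardFactors_apply_prime hp, pow_add, pow_one]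
      _ = (k + 1) * ∑ a ∈ n.divisors, k ^ Ω a := by ring
      _ ≤ (k + 1) * (k + 1) ^ Ω n := Nat.mul_le_mul_left _ ih
      _ = (k + 1) ^ Ω (p * n) := by
          rw [cardFactors_mul hp.ne_zero hn.ne', cardFactors_apply_prime hp, pow_add, pow_one]

/-- The natural numbers `1 ≤ n ≤ Y` coprime to `Q`. -/
noncomputable def coprimeUpTo (Q : ℕ) (Y : ℝ) : Finset ℕ := {n ∈ Icc 1 ⌊Y⌋₊ | n.Coprime Q}

theorem mem_coprimeUpTo {Q : ℕ} {Y : ℝ} {n : ℕ} :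
    n ∈ coprimeUpTo Q Y ↔ 1 ≤ n ∧ (n : ℝ) ≤ Y ∧ n.Coprime Q := by
  simp only [coprimeUpTo, mem_filter, mem_Icc, and_assoc]
  refine and_congr_right fun h => and_congr_left fun _ => ?_
  exact Nat.le_floor_iff' (by omega)

/-- The sum of `k ^ Ω(n) / n` over `n ≤ Y` coprime to `Q`. -/
noncomputable def powOmegaSum (k Q : ℕ) (Y : ℝ) : ℝ :=
  ∑ n ∈ coprimeUpTo Q Y, (k : ℝ) ^ Ω n / n

theorem sum_powOmegaSum_le (k Q : ℕ) (Y : ℝ) :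
    ∑ a ∈ coprimeUpTo Q Y, (a : ℝ)⁻¹ * powOmegaSum k Q (Y / a) ≤ powOmegaSum (k + 1) Q Y := by
  have h : ∀ n ∈ coprimeUpTo Q Y, ∑ b ∈ n.divisors, (k : ℝ) ^ Ω b / n ≤
      ((k + 1 : ℕ) : ℝ) ^ Ω n / n := by
    intro n _
    rw [← sum_div]
    gcongr
    exact_mod_cast sum_divisors_pow_cardFactors_le k n
  refine le_trans (le_of_eq ?_) (sum_le_sum h)
  simp only [powOmegaSum, mul_sum]
  rw [sum_sigma', sum_sigma']
  refine sum_nbij' (fun x => ⟨x.1 * x.2, x.2⟩) (fun x => ⟨x.1 / x.2, x.2⟩) ?_ ?_ ?_ ?_ ?_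
  · rintro ⟨a, b⟩ h
    simp only [mem_sigma, mem_coprimeUpTo, mem_divisors] at h ⊢
    obtain ⟨⟨ha1, ha2, ha3⟩, hb1, hb2, hb3⟩ := h
    have ha0 : (0 : ℝ) < a := by exact_mod_cast ha1
    refine ⟨⟨Nat.mul_pos ha1 hb1, ?_, Nat.Coprime.mul_left ha3 hb3⟩, dvd_mul_left _ _, ?_⟩
    · rw [le_div_iff₀ ha0] at hb2
      push_cast
      linarith
    · exact (Nat.mul_pos ha1 hb1).ne'
  · rintro ⟨n, b⟩ h
    simp only [mem_sigma, mem_coprimeUpTo, mem_divisors] at h ⊢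
    obtain ⟨⟨hn1, hn2, hn3⟩, ⟨a, rfl⟩, hn0⟩ := h
    have hb0 : 0 < b := Nat.pos_of_ne_zero (left_ne_zero_of_mul hn0)
    have ha0 : 0 < a := Nat.pos_of_ne_zero (right_ne_zero_of_mul hn0)
    have ha0' : (0 : ℝ) < a := by exact_mod_cast ha0
    have hb0' : (1 : ℝ) ≤ b := by exact_mod_cast hb0
    rw [Nat.mul_div_cancel_left _ hb0]
    push_cast at hn2
    refine ⟨⟨ha0, ?_, hn3.coprime_dvd_left (dvd_mul_left _ _)⟩, hb0, ?_,
      hn3.coprime_dvd_left (dvd_mul_right _ _)⟩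
    · nlinarith
    · rw [le_div_iff₀ ha0']; exact hn2
  · rintro ⟨a, b⟩ h
    simp only [mem_sigma, mem_coprimeUpTo] at h
    simp [Nat.mul_div_cancel _ h.2.1]
  · rintro ⟨n, b⟩ h
    simp only [mem_sigma, mem_divisors] at h
    simp [Nat.div_mul_cancel h.2.1]
  · rintro ⟨a, b⟩ h
    push_cast
    field_simp

theorem sum_coprime_sub_shift {Q N : ℕ} {L : ℕ → ℝ} (hL : ∀ b, N < b → L b = 0) :
    ∑ a ∈ Ico 1 (N + 1) with a.Coprime Q, (L a - L (a + Q)) =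
      ∑ a ∈ Ico 1 (Q + 1) with a.Coprime Q, L a := by
  rw [sum_filter, sum_filter]
  let F : ℕ → ℝ := fun a => if a.Coprime Q then L a else 0
  have h1 : ∀ a ∈ Ico 1 (N + 1), (if a.Coprime Q then L a - L (a + Q) else 0) =
      F a - F (a + Q) := by
    intro a _
    simp only [F, Nat.coprime_add_self_left]
    split_ifs <;> simp
  rw [sum_congr rfl h1, sum_sub_distrib, sum_Ico_add' F 1 (N + 1) Q]
  have h2 : ∑ a ∈ Ico 1 (N + 1), F a = ∑ a ∈ Ico 1 (N + 1 + Q), F a := by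
    rw [← sum_Ico_consecutive F (show 1 ≤ N + 1 by omega) (show N + 1 ≤ N + 1 + Q by omega)]
    rw [left_eq_add]
    refine sum_eq_zero fun a ha => ?_
    have := (mem_Ico.1 ha).1
    simp [F, hL a (by omega)]
  rw [h2, ← sum_Ico_consecutive F (show 1 ≤ 1 + Q by omega) (show 1 + Q ≤ N + 1 + Q by omega),
    add_sub_cancel_right, add_comm 1 Q]

theorem posLog_pow_sub_le {Q : ℕ} (hQ : 0 < Q) {Y : ℝ} (hY : 0 < Y) (k : ℕ) {a : ℕ} (ha : 1 ≤ a)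
    (haY : (a : ℝ) ≤ Y) :
    (Real.posLog (Y / a)) ^ (k + 1) - (Real.posLog (Y / (a + Q : ℕ))) ^ (k + 1) ≤
      (k + 1) * Q * ((a : ℝ)⁻¹ * Real.posLog (Y / a) ^ k) := by
  have ha0 : (0 : ℝ) < a := by exact_mod_cast ha
  have hQ0 : (0 : ℝ) < Q := by exact_mod_cast hQ
  set x := Real.posLog (Y / a)
  set y := Real.posLog (Y / (a + Q : ℕ))
  have hy0 : 0 ≤ y := Real.posLog_nonneg
  have hx0 : 0 ≤ x := Real.posLog_nonneg
  have hyx : y ≤ x := by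
    refine Real.posLog_le_posLog (by positivity) ?_
    gcongr
    linarith
  have hx : x = Real.log (Y / a) := by
    refine Real.posLog_eq_log ?_
    rw [abs_of_pos (by positivity), one_le_div ha0]
    exact haY
  have hy : Real.log (Y / (a + Q : ℕ)) ≤ y := le_max_right _ _
  have hsub : x - y ≤ Q * (a : ℝ)⁻¹ := by
    have h1 : x - y ≤ Real.log ((a + Q : ℕ) / (a : ℝ)) := by
      rw [hx]
      rw [Real.log_div hY.ne' (by positivity)] at hy ⊢
      rw [Real.log_div (by positivity) ha0.ne']
      linarith
    refine h1.trans ((Real.log_le_sub_one_of_pos (by positivity)).trans (le_of_eq ?_))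
    push_cast
    field_simp
    ring
  have hgeom : x ^ (k + 1) - y ^ (k + 1) ≤ (k + 1) * x ^ k * (x - y) := by
    rw [← geom_sum₂_mul]
    refine mul_le_mul_of_nonneg_right ?_ (by linarith)
    calc ∑ i ∈ range (k + 1), x ^ i * y ^ (k + 1 - 1 - i) ≤ ∑ i ∈ range (k + 1), x ^ k := by
          refine sum_le_sum fun i hi => ?_
          have hi' : i ≤ k := Nat.lt_succ_iff.1 (mem_range.1 hi)
          calc x ^ i * y ^ (k + 1 - 1 - i) ≤ x ^ i * x ^ (k - i) := by
                rw [Nat.add_sub_cancel]; gcongr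
            _ = x ^ k := by rw [← pow_add]; congr 1; omega
      _ = _ := by simp
  calc _ ≤ (k + 1) * x ^ k * (x - y) := hgeom
    _ ≤ (k + 1) * x ^ k * (Q * (a : ℝ)⁻¹) := by gcongr
    _ = _ := by ring

theorem sum_inv_mul_posLog_pow_ge {Q : ℕ} (hQ : 0 < Q) {Y Z : ℝ} (hY : 0 < Y) (hYZ : Y ≤ Z)
    (k : ℕ) :
    (Q.totient : ℝ) / Q / (k + 1) * Real.posLog (Y / Q) ^ (k + 1) ≤
      ∑ a ∈ coprimeUpTo Q Z, (a : ℝ)⁻¹ * Real.posLog (Y / a) ^ k := by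
  have hQ0 : (0 : ℝ) < Q := by exact_mod_cast hQ
  let L : ℕ → ℝ := fun a => Real.posLog (Y / a) ^ (k + 1)
  have hL0 : ∀ b : ℕ, ⌊Y⌋₊ < b → L b = 0 := by
    intro b hb
    have hb' : Y < b := (Nat.floor_lt hY.le).1 hb
    have hb0 : (0 : ℝ) < b := hY.trans hb'
    have : Real.posLog (Y / b) = 0 := by
      rw [Real.posLog_eq_zero_iff, abs_of_pos (by positivity), div_le_one hb0]
      exact hb'.le
    simp [L, this]
  have hsub : coprimeUpTo Q Y ⊆ coprimeUpTo Q Z := fun n hn => by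
    rw [mem_coprimeUpTo] at hn ⊢
    exact ⟨hn.1, hn.2.1.trans hYZ, hn.2.2⟩
  have h1 : ∑ a ∈ coprimeUpTo Q Y, (L a - L (a + Q)) =
      ∑ a ∈ Ico 1 (Q + 1) with a.Coprime Q, L a := by
    rw [← sum_coprime_sub_shift hL0]
    rfl
  have h2 : (Q.totient : ℝ) * L Q ≤ ∑ a ∈ Ico 1 (Q + 1) with a.Coprime Q, L a := by
    have hc : #{a ∈ Ico 1 (Q + 1) | a.Coprime Q} = Q.totient := by
      rw [← Nat.filter_coprime_Ico_eq_totient Q 1, add_comm 1 Q]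
      simp only [Nat.coprime_comm]
    rw [← hc, ← nsmul_eq_mul]
    refine card_nsmul_le_sum _ _ _ fun a ha => ?_
    have ha' := mem_Ico.1 (mem_filter.1 ha).1
    have ha0 : (0 : ℝ) < a := by exact_mod_cast ha'.1
    have haQ : (a : ℝ) ≤ Q := by exact_mod_cast Nat.lt_succ_iff.1 ha'.2
    refine pow_le_pow_left₀ Real.posLog_nonneg ?_ _
    refine Real.posLog_le_posLog (by positivity) ?_
    gcongr
  have h3 : ∑ a ∈ coprimeUpTo Q Y, (L a - L (a + Q)) ≤
      ∑ a ∈ coprimeUpTo Q Y, (k + 1) * Q * ((a : ℝ)⁻¹ * Real.posLog (Y / a) ^ k) := by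
    refine sum_le_sum fun a ha => ?_
    rw [mem_coprimeUpTo] at ha
    exact posLog_pow_sub_le hQ hY k ha.1 ha.2.1
  rw [← mul_sum] at h3
  have h4 : ∑ a ∈ coprimeUpTo Q Y, (a : ℝ)⁻¹ * Real.posLog (Y / a) ^ k ≤
      ∑ a ∈ coprimeUpTo Q Z, (a : ℝ)⁻¹ * Real.posLog (Y / a) ^ k :=
    sum_le_sum_of_subset_of_nonneg hsub fun a _ _ => by
      have : 0 ≤ Real.posLog (Y / a) := Real.posLog_nonneg
      positivity
  refine le_trans ?_ h4
  rw [h1] at h3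
  have h5 := h2.trans h3
  rw [div_div, div_mul_eq_mul_div, div_le_iff₀ (by positivity)]
  calc _ ≤ _ := h5
    _ = _ := by ring

theorem powOmegaSum_ge {Q : ℕ} (hQ : 0 < Q) (k : ℕ) {Y : ℝ} (hY : 1 ≤ Y) :
    ((Q.totient : ℝ) / Q) ^ k / k ! * Real.posLog (Y / Q ^ k) ^ k ≤ powOmegaSum k Q Y := by
  have hQ0 : (0 : ℝ) < Q := by exact_mod_cast hQ
  induction k generalizing Y with
  | zero =>
    have h1 : 1 ∈ coprimeUpTo Q Y := by
      rw [mem_coprimeUpTo]; simpa using hY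
    have := single_le_sum (f := fun n : ℕ => ((0 : ℕ) : ℝ) ^ Ω n / n)
      (fun n _ => by positivity) h1
    simpa [powOmegaSum] using this
  | succ k ih =>
    refine le_trans ?_ (sum_powOmegaSum_le k Q Y)
    have h1 : ∀ a ∈ coprimeUpTo Q Y, ((Q.totient : ℝ) / Q) ^ k / k ! *
        ((a : ℝ)⁻¹ * Real.posLog (Y / Q ^ k / a) ^ k) ≤ (a : ℝ)⁻¹ * powOmegaSum k Q (Y / a) := by
      intro a ha
      rw [mem_coprimeUpTo] at ha
      have ha0 : (0 : ℝ) < a := by exact_mod_cast ha.1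
      have := ih (Y := Y / a) ((one_le_div ha0).2 ha.2.1)
      rw [mul_left_comm, div_right_comm]
      gcongr
    refine le_trans ?_ (sum_le_sum h1)
    rw [← mul_sum]
    have hQk : (1 : ℝ) ≤ Q ^ k := one_le_pow₀ (by exact_mod_cast hQ)
    have h2 := sum_inv_mul_posLog_pow_ge hQ (Y := Y / Q ^ k) (Z := Y) (by positivity)
      (div_le_self (by linarith) hQk) k
    have h3 : Y / (Q : ℝ) ^ (k + 1) = Y / Q ^ k / Q := by rw [pow_succ, div_div]
    rw [h3]
    calc _ = ((Q.totient : ℝ) / Q) ^ k / k ! *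
          ((Q.totient : ℝ) / Q / (k + 1) * Real.posLog (Y / Q ^ k / Q) ^ (k + 1)) := by
          rw [Nat.factorial_succ]
          push_cast
          rw [pow_succ ((Q.totient : ℝ) / Q)]
          field_simp
      _ ≤ _ := by gcongr

end AbarSieve

namespace AbarSieve
open Finset Nat ArithmeticFunction
open scoped ArithmeticFunction.Omega

theorem three_pow_cardFactors_div {n : ℕ} (hn : n ≠ 0) :
    (3 : ℝ) ^ Ω n / n = ∏ p ∈ n.primeFactors, (3 / (p : ℝ)) ^ n.factorization p := by
  have h1 : (3 : ℝ) ^ Ω n = ∏ p ∈ n.primeFactors, (3 : ℝ) ^ n.factorization p := by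
    rw [prod_pow_eq_pow_sum, cardFactors_eq_sum_factorization]
    rfl
  have h2 : (n : ℝ) = ∏ p ∈ n.primeFactors, (p : ℝ) ^ n.factorization p := by
    conv_lhs => rw [← Nat.prod_factorization_pow_eq_self hn]
    rw [Nat.prod_factorization_eq_prod_primeFactors]
    push_cast
    rfl
  rw [h1]
  conv_lhs => rw [h2]
  rw [← prod_div_distrib]
  simp only [div_pow]

theorem sum_primeFactors_eq_le {A : Finset ℕ} (hA : ∀ p ∈ A, 5 ≤ p) (S : Finset ℕ)
    (hS : ∀ n ∈ S, n ≠ 0 ∧ n.primeFactors = A) :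
    ∑ n ∈ S, (3 : ℝ) ^ Ω n / n ≤ ∏ p ∈ A, 3 / ((p : ℝ) - 3) := by
  set J := S.sup id
  have hgeom : ∀ p ∈ A, ∑ j ∈ Icc 1 J, (3 / (p : ℝ)) ^ j ≤ 3 / ((p : ℝ) - 3) := by
    intro p hp
    have h5 : (5 : ℝ) ≤ p := by exact_mod_cast hA p hp
    set x := 3 / (p : ℝ)
    have hx0 : 0 < x := by positivity
    have hx1 : x < 1 := by rw [div_lt_one (by linarith)]; linarith
    have hx : 3 / ((p : ℝ) - 3) = x / (1 - x) := by
      have : (p : ℝ) - 3 ≠ 0 := by linarith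
      have h1 : 1 - x ≠ 0 := by linarith
      have h2 : x * p = 3 := by simp only [x]; field_simp
      rw [div_eq_div_iff this h1]
      linear_combination -h2
    rw [hx, le_div_iff₀ (by linarith)]
    have : ∀ J : ℕ, (∑ j ∈ Icc 1 J, x ^ j) * (1 - x) = x - x ^ (J + 1) := by
      intro J
      induction J with
      | zero => simp
      | succ J ih => rw [sum_Icc_succ_top (by omega), add_mul, ih]; ring
    rw [this]
    have := pow_pos hx0 (J + 1)
    linarith
  calc ∑ n ∈ S, (3 : ℝ) ^ Ω n / n
      = ∑ n ∈ S, ∏ x ∈ A.attach, (3 / (x.1 : ℝ)) ^ n.factorization x.1 := by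
        refine sum_congr rfl fun n hn => ?_
        rw [three_pow_cardFactors_div (hS n hn).1, (hS n hn).2,
          prod_attach A fun p => (3 / (p : ℝ)) ^ n.factorization p]
    _ = ∑ e ∈ S.image fun n (p : ℕ) (_ : p ∈ A) => n.factorization p,
          ∏ x ∈ A.attach, (3 / (x.1 : ℝ)) ^ e x.1 x.2 := by
        rw [sum_image]
        intro a ha b hb hab
        refine Nat.eq_of_factorization_eq (hS a ha).1 (hS b hb).1 fun p => ?_
        by_cases hp : p ∈ A
        · exact congrFun (congrFun hab p) hp
        · rw [Finsupp.notMem_support_iff.1 (by rwa [Nat.support_factorization, (hS a ha).2]),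
            Finsupp.notMem_support_iff.1 (by rwa [Nat.support_factorization, (hS b hb).2])]
    _ ≤ ∑ e ∈ A.pi fun _ => Icc 1 J, ∏ x ∈ A.attach, (3 / (x.1 : ℝ)) ^ e x.1 x.2 := by
        refine sum_le_sum_of_subset_of_nonneg ?_ fun _ _ _ => by positivity
        intro e he
        obtain ⟨n, hn, rfl⟩ := mem_image.1 he
        rw [Finset.mem_pi]
        intro p hp
        have hp' : p ∈ n.primeFactors := by rwa [(hS n hn).2]
        rw [mem_Icc]
        refine ⟨Nat.pos_of_ne_zero (Finsupp.mem_support_iff.1 hp'), ?_⟩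
        exact (Nat.factorization_lt p (hS n hn).1).le.trans (le_sup (f := id) hn)
    _ = ∏ p ∈ A, ∑ j ∈ Icc 1 J, (3 / (p : ℝ)) ^ j := by
        rw [Finset.prod_sum]
    _ ≤ _ := prod_le_prod (fun _ _ => sum_nonneg fun _ _ => by positivity) hgeom

theorem five_le_of_mem_primeFactors {Q n p : ℕ} (h6 : 6 ∣ Q) (hn : n.Coprime Q)
    (hp : p ∈ n.primeFactors) : 5 ≤ p :=
  five_le_of_coprime_six (Nat.prime_of_mem_primeFactors hp)
    ((hn.coprime_dvd_right h6).coprime_dvd_left (dvd_of_mem_primeFactors hp))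

theorem powOmegaSum_three_le {Q : ℕ} (h6 : 6 ∣ Q) (Y : ℝ) :
    powOmegaSum 3 Q Y ≤
      ∑ d ∈ coprimeUpTo Q Y with Squarefree d, ∏ p ∈ d.primeFactors, 3 / ((p : ℝ) - 3) := by
  rw [powOmegaSum, ← sum_fiberwise_of_maps_to (g := fun n => ∏ p ∈ n.primeFactors, p)
    (t := {d ∈ coprimeUpTo Q Y | Squarefree d})]
  · refine sum_le_sum fun d hd => ?_
    simp only [mem_filter, mem_coprimeUpTo] at hd
    push_cast
    refine sum_primeFactors_eq_le
      (fun p hp => five_le_of_mem_primeFactors h6 hd.1.2.2 hp) _ fun n hn => ?_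
    simp only [mem_filter, mem_coprimeUpTo] at hn
    refine ⟨by omega, ?_⟩
    rw [← hn.2, Nat.primeFactors_prod fun p hp => Nat.prime_of_mem_primeFactors hp]
  · intro n hn
    simp only [mem_filter, mem_coprimeUpTo] at hn ⊢
    have hdvd := Nat.prod_primeFactors_dvd n
    have hpos := Nat.pos_of_dvd_of_pos hdvd hn.1
    refine ⟨⟨hpos, ?_, hn.2.2.coprime_dvd_left hdvd⟩, ?_⟩
    · refine le_trans ?_ hn.2.1
      exact_mod_cast Nat.le_of_dvd hn.1 hdvd
    · refine Finset.squarefree_prod_of_pairwise_isCoprime (f := fun p : ℕ => p) ?_ ?_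
      · intro p hp q hq hpq
        exact Nat.coprime_iff_isRelPrime.1 ((Nat.coprime_primes
          (Nat.prime_of_mem_primeFactors hp) (Nat.prime_of_mem_primeFactors hq)).2 hpq)
      · intro p hp
        exact (Nat.prime_of_mem_primeFactors hp).prime.squarefree

variable {T : Finset ℕ}

theorem squarefree_prod_primes (hT : ∀ p ∈ T, p.Prime) : Squarefree (∏ p ∈ T, p) := by
  refine Finset.squarefree_prod_of_pairwise_isCoprime (f := fun p : ℕ => p) ?_ ?_
  · intro p hp q hq hpq
    exact Nat.coprime_iff_isRelPrime.1 ((Nat.coprime_primes (hT p hp) (hT q hq)).2 hpq)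
  · intro p hp
    exact (hT p hp).prime.squarefree

theorem mainDenominator_ge_mul_sum (hT : ∀ p ∈ T, p.Prime ∧ 5 ≤ p) (R : ℕ) :
    (∏ p ∈ T, (1 + 3 / ((p : ℝ) - 3))) *
      ∑ d ∈ coprimeUpTo (6 * ∏ p ∈ T, p) (R / (∏ p ∈ T, p : ℕ)) with Squarefree d,
        ∏ p ∈ d.primeFactors, 3 / ((p : ℝ) - 3) ≤ mainDenominator R := by
  set t := ∏ p ∈ T, p
  have hT' : ∀ p ∈ T, p.Prime := fun p hp => (hT p hp).1
  have ht0 : 0 < t := prod_pos fun p hp => (hT' p hp).pos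
  have ht6 : t.Coprime 6 := by
    refine Nat.Coprime.prod_left fun p hp => ?_
    rw [(hT' p hp).coprime_iff_not_dvd]
    intro h
    have := Nat.le_of_dvd (by norm_num) h
    have h5 := (hT p hp).2
    have hpr := hT' p hp
    interval_cases p <;> revert h hpr <;> decide
  rw [Finset.prod_one_add, sum_mul_sum, ← sum_product']
  set D := {d ∈ coprimeUpTo (6 * t) (R / (t : ℕ)) | Squarefree d}
  have hD : ∀ d ∈ D, 0 < d ∧ t * d ≤ R ∧ d.Coprime 6 ∧ d.Coprime t ∧ Squarefree d := by
    intro d hd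
    simp only [D, mem_filter, mem_coprimeUpTo] at hd
    obtain ⟨⟨h1, h2, h3⟩, h4⟩ := hd
    refine ⟨h1, ?_, h3.coprime_dvd_right (dvd_mul_right _ _),
      h3.coprime_dvd_right (dvd_mul_left _ _), h4⟩
    rw [le_div_iff₀ (by exact_mod_cast ht0)] at h2
    rw [mul_comm]
    exact_mod_cast h2
  have hB : ∀ B ∈ T.powerset, (∏ p ∈ B, p) ∣ t ∧ (∏ p ∈ B, p).primeFactors = B ∧
      Squarefree (∏ p ∈ B, p) := by
    intro B hB
    have hB' := mem_powerset.1 hB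
    exact ⟨prod_dvd_prod_of_subset _ _ _ hB', Nat.primeFactors_prod fun p hp => hT' p (hB' hp),
      squarefree_prod_primes fun p hp => hT' p (hB' hp)⟩
  have hcop : ∀ x ∈ T.powerset ×ˢ D, (∏ p ∈ x.1, p).Coprime x.2 := by
    intro x hx
    rw [mem_product] at hx
    exact (hD _ hx.2).2.2.2.1.symm.coprime_dvd_left (hB _ hx.1).1
  have hpf : ∀ x ∈ T.powerset ×ˢ D,
      ((∏ p ∈ x.1, p) * x.2).primeFactors = x.1 ∪ x.2.primeFactors ∧
        Disjoint x.1 x.2.primeFactors := by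
    intro x hx
    have hx' := mem_product.1 hx
    refine ⟨?_, ?_⟩
    · rw [(hcop x hx).primeFactors_mul, (hB _ hx'.1).2.1]
    · rw [← (hB _ hx'.1).2.1]
      exact (hcop x hx).disjoint_primeFactors
  calc ∑ x ∈ T.powerset ×ˢ D, (∏ p ∈ x.1, 3 / ((p : ℝ) - 3)) *
        ∏ p ∈ x.2.primeFactors, 3 / ((p : ℝ) - 3)
      = ∑ x ∈ T.powerset ×ˢ D,
          ∏ p ∈ ((∏ p ∈ x.1, p) * x.2).primeFactors, 3 / ((p : ℝ) - 3) := by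
        refine sum_congr rfl fun x hx => ?_
        rw [(hpf x hx).1, prod_union (hpf x hx).2]
    _ = ∑ n ∈ ((T.powerset ×ˢ D).image fun x => (∏ p ∈ x.1, p) * x.2 : Finset ℕ),
          ∏ p ∈ n.primeFactors, 3 / ((p : ℝ) - 3) := by
        rw [sum_image]
        intro x hx y hy hxy
        have hgcd : ∀ x ∈ T.powerset ×ˢ D, ((∏ p ∈ x.1, p) * x.2).primeFactors ∩ T = x.1 := by
          intro x hx
          have hx' := mem_product.1 hx
          rw [(hpf x hx).1, union_inter_distrib_right,
            inter_eq_left.2 (mem_powerset.1 hx'.1)]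
          have hdis : x.2.primeFactors ∩ T = ∅ := by
            have := (hD _ hx'.2).2.2.2.1.disjoint_primeFactors
            rw [Nat.primeFactors_prod hT'] at this
            exact disjoint_iff_inter_eq_empty.1 this
          rw [hdis, union_empty]
        have h1 : x.1 = y.1 := by
          rw [← hgcd x hx, ← hgcd y hy]
          simp only at hxy
          rw [hxy]
        refine Prod.ext h1 ?_
        simp only [h1] at hxy
        refine Nat.eq_of_mul_eq_mul_left ?_ hxy
        exact Nat.pos_of_ne_zero (hB _ (mem_product.1 hy).1).2.2.ne_zero
    _ ≤ mainDenominator R := by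
        refine sum_le_sum_of_subset_of_nonneg ?_ ?_
        · intro n hn
          obtain ⟨x, hx, rfl⟩ := mem_image.1 hn
          have hx' := mem_product.1 hx
          obtain ⟨h1, h2, h3, h4, h5⟩ := hD _ hx'.2
          obtain ⟨b1, b2, b3⟩ := hB _ hx'.1
          have hle : (∏ p ∈ x.1, p) * x.2 ≤ R :=
            (Nat.mul_le_mul_right _ (Nat.le_of_dvd ht0 b1)).trans h2
          rw [mem_filter, mem_divisors]
          refine ⟨⟨dvd_primeProd ?_ ?_ hle, (squarefree_primeProd R).ne_zero⟩, hle⟩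
          · exact (Nat.squarefree_mul (hcop x hx)).2 ⟨b3, h5⟩
          · exact Nat.Coprime.mul_left (ht6.coprime_dvd_left b1) h3
        · intro n hn _
          refine prod_nonneg fun p hp => div_nonneg (by norm_num) ?_
          have hn' := dvd_of_mem_divisors (mem_filter.1 hn).1
          have h5 : (5 : ℝ) ≤ p := by
            exact_mod_cast ((prime_dvd_primeProd (R := R) (Nat.prime_of_mem_primeFactors hp)).1
              ((dvd_of_mem_primeFactors hp).trans hn')).2
          linarith

theorem totient_six_mul_prod_div (hT : ∀ p ∈ T, p.Prime ∧ 5 ≤ p) :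
    ((6 * ∏ p ∈ T, p).totient : ℝ) / (6 * ∏ p ∈ T, p : ℕ) =
      1 / 3 * ∏ p ∈ T, (1 - 1 / (p : ℝ)) := by
  have hT' : ∀ p ∈ T, p.Prime := fun p hp => (hT p hp).1
  have ht0 : 0 < ∏ p ∈ T, p := prod_pos fun p hp => (hT' p hp).pos
  have hpf : (6 * ∏ p ∈ T, p).primeFactors = {2, 3} ∪ T := by
    rw [Nat.primeFactors_mul (by norm_num) ht0.ne', Nat.primeFactors_prod hT']
    congr 1
    rw [show 6 = 2 * 3 from rfl, Nat.primeFactors_mul (by norm_num) (by norm_num),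
      Nat.prime_two.primeFactors, Nat.prime_three.primeFactors]
    rfl
  have hdis : Disjoint ({2, 3} : Finset ℕ) T := by
    rw [disjoint_left]
    intro a ha haT
    have := (hT a haT).2
    simp only [mem_insert, mem_singleton] at ha
    omega
  have h := Nat.totient_eq_mul_prod_factors (6 * ∏ p ∈ T, p)
  rw [hpf, prod_union hdis] at h
  have h' : ((6 * ∏ p ∈ T, p).totient : ℝ) = (6 * ∏ p ∈ T, p : ℕ) *
      ((∏ p ∈ ({2, 3} : Finset ℕ), (1 - (p : ℝ)⁻¹)) * ∏ p ∈ T, (1 - (p : ℝ)⁻¹)) := by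
    have h2 := congrArg (Rat.cast : ℚ → ℝ) h
    push_cast at h2 ⊢
    exact h2
  rw [h', mul_div_cancel_left₀ _ (by positivity)]
  simp only [one_div]
  congr 1
  rw [prod_insert (by simp), prod_singleton]
  norm_num

/-- The partial singular product over `T`. -/
noncomputable def singularProd (T : Finset ℕ) : ℝ :=
  ∏ p ∈ T, ((1 - 3 / (p : ℝ)) * ((1 - 1 / (p : ℝ))⁻¹) ^ 3)

theorem exists_mainDenominator_ge (hT : ∀ p ∈ T, p.Prime ∧ 5 ≤ p) :
    ∃ C : ℝ, 1 ≤ C ∧ ∀ R : ℕ, C ≤ R →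
      (singularProd T)⁻¹ / 162 * Real.log (R / C) ^ 3 ≤ mainDenominator R := by
  set t := ∏ p ∈ T, p
  have ht0 : 0 < t := prod_pos fun p hp => (hT p hp).1.pos
  have ht1 : (1 : ℝ) ≤ t := by exact_mod_cast ht0
  have hQ1 : (1 : ℝ) ≤ (6 * t : ℕ) := by exact_mod_cast (by omega : 1 ≤ 6 * t)
  have hQ3 : (1 : ℝ) ≤ ((6 * t : ℕ) : ℝ) ^ 3 := one_le_pow₀ hQ1
  refine ⟨t * ((6 * t : ℕ) : ℝ) ^ 3, one_le_mul_of_one_le_of_one_le ht1 hQ3, fun R hR => ?_⟩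
  have hRt : (1 : ℝ) ≤ R / t := by
    rw [one_le_div (by linarith)]
    nlinarith
  have hfac : ∀ p ∈ T, 0 < 1 + 3 / ((p : ℝ) - 3) ∧
      1 + 3 / ((p : ℝ) - 3) = (1 - 3 / (p : ℝ))⁻¹ := by
    intro p hp
    have h5 : (5 : ℝ) ≤ p := by exact_mod_cast (hT p hp).2
    have h3 : (p : ℝ) - 3 ≠ 0 := by linarith
    have h0 : (p : ℝ) ≠ 0 := by linarith
    refine ⟨?_, ?_⟩
    · have : 0 < 3 / ((p : ℝ) - 3) := div_pos (by norm_num) (by linarith)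
      linarith
    · have : 1 - 3 / (p : ℝ) = (p - 3) / p := by field_simp
      rw [this, inv_div]
      field_simp
      ring
  have h1 := mainDenominator_ge_mul_sum hT R
  have h2 := powOmegaSum_three_le (Q := 6 * t) (dvd_mul_right _ _) (R / t)
  have h3 := powOmegaSum_ge (Q := 6 * t) (by omega) 3 hRt
  rw [totient_six_mul_prod_div hT, div_div, Real.posLog_eq_log] at h3
  · refine le_trans ?_ h1
    refine le_trans (le_of_eq ?_) (mul_le_mul_of_nonneg_left (h3.trans h2)
      (prod_nonneg fun p hp => (hfac p hp).1.le))
    rw [prod_congr rfl fun p hp => (hfac p hp).2, singularProd, prod_mul_distrib, prod_pow,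
      prod_inv_distrib, prod_inv_distrib, mul_inv, inv_pow, inv_inv]
    simp only [Nat.factorial]
    push_cast
    ring
  · rw [abs_of_nonneg (by positivity), one_le_div (by positivity)]
    exact hR

end AbarSieve

namespace AbarSieve
open Finset Nat

theorem lt_log_add_one_of_pow_le {N a b : ℕ} (ha : 2 ≤ a) (h : a ^ b ≤ N + 1) :
    b < Nat.log 2 (N + 1) + 1 := by
  have h2 : 2 ^ b ≤ N + 1 := (Nat.pow_le_pow_left ha b).trans h
  have := Nat.le_log_of_pow_le (by norm_num) h2
  omega

/-- The integers `2 ^ α * 3 ^ β * q ^ μ - 1` and `2 ^ γ * r ^ ν + 1` with `q, r ≤ R` and exponents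
less than `L`, together with the integers at most `R`. -/
def smallFactorSet (R L : ℕ) : Finset ℕ :=
  range (R + 1) ∪
    ((range L ×ˢ range L ×ˢ range L ×ˢ range (R + 1)).image
      (fun t => 2 ^ t.1 * 3 ^ t.2.1 * t.2.2.2 ^ t.2.2.1 - 1) ∪
    (range L ×ˢ range L ×ˢ range (R + 1)).image (fun t => 2 ^ t.1 * t.2.2 ^ t.2.1 + 1))

theorem card_smallFactorSet_le (R : ℕ) {L : ℕ} (hL : 1 ≤ L) :
    #(smallFactorSet R L) ≤ 3 * ((R + 1) * L ^ 3) := by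
  have h1 : #(range (R + 1)) ≤ (R + 1) * L ^ 3 := by
    rw [card_range]
    exact Nat.le_mul_of_pos_right _ (by positivity)
  have h2 : #((range L ×ˢ range L ×ˢ range L ×ˢ range (R + 1)).image
      (fun t => 2 ^ t.1 * 3 ^ t.2.1 * t.2.2.2 ^ t.2.2.1 - 1)) ≤ (R + 1) * L ^ 3 := by
    refine card_image_le.trans (le_of_eq ?_)
    simp only [card_product, card_range]
    ring
  have h3 : #((range L ×ˢ range L ×ˢ range (R + 1)).image
      (fun t => 2 ^ t.1 * t.2.2 ^ t.2.1 + 1)) ≤ (R + 1) * L ^ 3 := by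
    refine card_image_le.trans ?_
    simp only [card_product, card_range]
    calc L * (L * (R + 1)) = (R + 1) * L ^ 2 := by ring
      _ ≤ (R + 1) * L ^ 3 := by gcongr; omega
  have h4 := card_union_le (range (R + 1))
    ((range L ×ˢ range L ×ˢ range L ×ˢ range (R + 1)).image
      (fun t => 2 ^ t.1 * 3 ^ t.2.1 * t.2.2.2 ^ t.2.2.1 - 1) ∪
    (range L ×ˢ range L ×ˢ range (R + 1)).image (fun t => 2 ^ t.1 * t.2.2 ^ t.2.1 + 1))
  have h5 := card_union_le ((range L ×ˢ range L ×ˢ range L ×ˢ range (R + 1)).image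
      (fun t => 2 ^ t.1 * 3 ^ t.2.1 * t.2.2.2 ^ t.2.2.1 - 1))
    ((range L ×ˢ range L ×ˢ range (R + 1)).image (fun t => 2 ^ t.1 * t.2.2 ^ t.2.1 + 1))
  rw [smallFactorSet]
  omega

theorem Abar_inter_subset (N R : ℕ) :
    Abar ∩ {n | n ≤ N} ⊆
      (({m ∈ range (N / 6 + 1) | (primeProd R).Coprime (tripleProd m)}.image (6 * · + 5) ∪
        smallFactorSet R (Nat.log 2 (N + 1) + 1) : Finset ℕ) : Set ℕ) := by
  rintro p ⟨⟨hp, hp3, α, β, γ, μ, ν, q, r, hα, hβ, hγ, hμ, hν, hq, hr, hq6, hr6, h1, h2⟩, hpN⟩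
  change p ≤ N at hpN
  have hα' : 2 ^ α ∣ p + 1 := h1 ▸ Dvd.intro _ (mul_assoc _ _ _).symm
  have hβ' : 3 ^ β ∣ p + 1 := h1 ▸ (Dvd.intro_left _ rfl).mul_right _
  have hμ' : q ^ μ ∣ p + 1 := h1 ▸ Dvd.intro_left _ rfl
  have hp1 : p - 1 ≠ 0 := by have := hp.two_le; omega
  have hγ' : 2 ^ γ ∣ p - 1 := h2 ▸ Dvd.intro _ rfl
  have hν' : r ^ ν ∣ p - 1 := h2 ▸ Dvd.intro_left _ rfl
  have hlog : ∀ {a b : ℕ}, 2 ≤ a → a ^ b ∣ p + 1 → b < Nat.log 2 (N + 1) + 1 :=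
    fun ha h => lt_log_add_one_of_pow_le ha ((Nat.le_of_dvd (by omega) h).trans (by omega))
  have hlog' : ∀ {a b : ℕ}, 2 ≤ a → a ^ b ∣ p - 1 → b < Nat.log 2 (N + 1) + 1 :=
    fun ha h => lt_log_add_one_of_pow_le ha ((Nat.le_of_dvd (by omega) h).trans (by omega))
  have h2dvd : 2 ∣ p + 1 := (dvd_pow_self 2 (by omega)).trans hα'
  rw [mem_coe, mem_union]
  by_cases hpR : p ≤ R
  · right
    exact mem_union_left _ (mem_range.2 (by omega))
  by_cases hqR : q ≤ R
  · right
    refine mem_union_right _ (mem_union_left _ (mem_image.2 ⟨(α, β, μ, q), ?_, ?_⟩))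
    · simp only [mem_product, mem_range]
      exact ⟨hlog le_rfl hα', hlog (by norm_num) hβ', hlog hq.two_le hμ', by omega⟩
    · simp only [← h1]
      omega
  by_cases hrR : r ≤ R
  · right
    refine mem_union_right _ (mem_union_right _ (mem_image.2 ⟨(γ, ν, r), ?_, ?_⟩))
    · simp only [mem_product, mem_range]
      exact ⟨hlog' le_rfl hγ', hlog' hr.two_le hν', by omega⟩
    · simp only [← h2]
      omega
  left
  have hpm : p = 6 * (p / 6) + 5 := by omega
  refine mem_image.2 ⟨p / 6, mem_filter.2 ⟨mem_range.2 (by omega), ?_⟩, hpm.symm⟩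
  refine Nat.Coprime.symm (Nat.coprime_of_dvd fun l hl hl1 hl2 => ?_)
  rw [prime_dvd_primeProd hl] at hl2
  have hprime : ∀ {a b : ℕ}, a.Prime → l ∣ a ^ b → l = a := fun ha h =>
    (Nat.prime_dvd_prime_iff_eq hl ha).1 (hl.dvd_of_dvd_pow h)
  rw [tripleProd, show 6 * (p / 6) + 4 = p - 1 by omega, ← hpm,
    show 6 * (p / 6) + 6 = p + 1 by omega, hl.dvd_mul, hl.dvd_mul, h1, h2, hl.dvd_mul, hl.dvd_mul,
    hl.dvd_mul] at hl1
  rcases hl1 with ((h | h) | h) | (h | h) | h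
  · have := hprime Nat.prime_two h; omega
  · have := hprime hr h; omega
  · have := (Nat.prime_dvd_prime_iff_eq hl hp).1 h; omega
  · have := hprime Nat.prime_two h; omega
  · have := hprime Nat.prime_three h; omega
  · have := hprime hq h; omega

theorem ncard_Abar_inter_le (N R : ℕ) :
    (Abar ∩ {n | n ≤ N}).ncard ≤
      #{m ∈ range (N / 6 + 1) | (primeProd R).Coprime (tripleProd m)} +
        3 * ((R + 1) * (Nat.log 2 (N + 1) + 1) ^ 3) := by
  refine (Set.ncard_le_ncard (Abar_inter_subset N R) (Finset.finite_toSet _)).trans ?_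
  rw [Set.ncard_coe_finset]
  refine (card_union_le _ _).trans (Nat.add_le_add card_image_le ?_)
  exact card_smallFactorSet_le R (by omega)

end AbarSieve

namespace AbarSieve
open Finset Nat Filter Topology

theorem singularFactor_pos {p : ℕ} (hp : 5 ≤ p) :
    0 < (1 - 3 / (p : ℝ)) * ((1 - 1 / (p : ℝ))⁻¹) ^ 3 := by
  have h5 : (5 : ℝ) ≤ p := by exact_mod_cast hp
  have h1 : 3 / (p : ℝ) < 1 := by rw [div_lt_one (by linarith)]; linarith
  have h2 : 1 / (p : ℝ) < 1 := by rw [div_lt_one (by linarith)]; linarith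
  have h3 : 0 < 1 - 1 / (p : ℝ) := by linarith
  have h4 : 0 < 1 - 3 / (p : ℝ) := by linarith
  positivity

theorem singularFactor_le_one {p : ℕ} (hp : 5 ≤ p) :
    (1 - 3 / (p : ℝ)) * ((1 - 1 / (p : ℝ))⁻¹) ^ 3 ≤ 1 := by
  have h5 : (5 : ℝ) ≤ p := by exact_mod_cast hp
  have h2 : 1 / (p : ℝ) < 1 := by rw [div_lt_one (by linarith)]; linarith
  have h3 : 0 < (1 - 1 / (p : ℝ)) ^ 3 := pow_pos (by linarith) 3
  rw [inv_pow, ← div_eq_mul_inv, div_le_one h3]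
  have h0 : 0 < 1 / (p : ℝ) := by positivity
  rw [show 3 / (p : ℝ) = 3 * (1 / (p : ℝ)) by ring]
  nlinarith [sq_nonneg (1 / (p : ℝ))]

theorem singularProd_pos {T : Finset ℕ} (hT : ∀ p ∈ T, p.Prime ∧ 5 ≤ p) : 0 < singularProd T :=
  prod_pos fun p hp => singularFactor_pos (hT p hp).2

theorem SA_eq_iInf :
    SA = 9 * ⨅ T : Finset {p : ℕ // p.Prime ∧ 5 ≤ p},
      singularProd (T.map (Function.Embedding.subtype _)) := by
  have hanti : Antitone fun T : Finset {p : ℕ // p.Prime ∧ 5 ≤ p} =>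
      ∏ p ∈ T, (1 - 3 / (p.1 : ℝ)) * ((1 - 1 / (p.1 : ℝ))⁻¹) ^ 3 := by
    exact prod_anti_set_of_le_one (fun p => (singularFactor_pos p.2.2).le)
      fun p => singularFactor_le_one p.2.2
  have hbdd : BddBelow (Set.range fun T : Finset {p : ℕ // p.Prime ∧ 5 ≤ p} =>
      ∏ p ∈ T, (1 - 3 / (p.1 : ℝ)) * ((1 - 1 / (p.1 : ℝ))⁻¹) ^ 3) := by
    refine ⟨0, ?_⟩
    rintro _ ⟨T, rfl⟩
    exact prod_nonneg fun p _ => (singularFactor_pos p.2.2).le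
  have h : HasProd (fun p : {p : ℕ // p.Prime ∧ 5 ≤ p} =>
      (1 - 3 / (p.1 : ℝ)) * ((1 - 1 / (p.1 : ℝ))⁻¹) ^ 3) _ :=
    tendsto_atTop_ciInf hanti hbdd
  rw [SA, h.tprod_eq]
  simp [singularProd]

theorem tendsto_log_pow_mul_rpow_neg (n : ℕ) {s : ℝ} (hs : 0 < s) :
    Tendsto (fun x : ℝ => Real.log x ^ n * x ^ (-s)) atTop (𝓝 0) := by
  have h := (isLittleO_log_rpow_rpow_atTop (n : ℝ) hs).tendsto_div_nhds_zero
  refine h.congr' ?_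
  filter_upwards [eventually_gt_atTop 0] with x hx
  rw [Real.rpow_natCast, Real.rpow_neg hx.le, div_eq_mul_inv]

theorem tendsto_log_div (c : ℝ) {θ : ℝ} (hθ : 0 < θ) :
    Tendsto (fun x : ℝ => Real.log x / (θ * Real.log x - c)) atTop (𝓝 θ⁻¹) := by
  have h1 : Tendsto (fun x : ℝ => (θ - c / Real.log x)⁻¹) atTop (𝓝 (θ - 0)⁻¹) := by
    refine Tendsto.inv₀ (tendsto_const_nhds.sub ?_) (by linarith)
    exact Real.tendsto_log_atTop.const_div_atTop c
  rw [sub_zero] at h1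
  refine h1.congr' ?_
  filter_upwards [eventually_gt_atTop 1] with x hx
  have := Real.log_pos hx
  rw [show θ - c / Real.log x = (θ * Real.log x - c) / Real.log x by field_simp, inv_div]

end AbarSieve

namespace AbarSieve
open Finset Nat Filter Topology

/-- The counting function of `Abar` normalised by `x / (log x) ^ 3`. -/
noncomputable def normalizedCount (x : ℝ) : ℝ :=
  ((Abar ∩ {n : ℕ | (n : ℝ) ≤ x}).ncard : ℝ) / (x / (Real.log x) ^ 3)

theorem exists_ncard_Abar_le {T : Finset ℕ} (hT : ∀ p ∈ T, p.Prime ∧ 5 ≤ p) {ε : ℝ} (hε : 0 < ε) :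
    ∃ C : ℝ, 1 ≤ C ∧ ∀ (R : ℕ) (x : ℝ), C < R → 0 ≤ x →
      ((Abar ∩ {n : ℕ | (n : ℝ) ≤ x}).ncard : ℝ) ≤
        (x / 6 + 1) * (162 * singularProd T / Real.log (R / C) ^ 3) +
          (C * (R : ℝ) ^ (1 + ε)) ^ 2 +
          3 * ((R + 1) * (Nat.log 2 (⌊x⌋₊ + 1) + 1 : ℕ) ^ 3) := by
  obtain ⟨C₁, h1, hC₁⟩ := exists_mainDenominator_ge hT
  obtain ⟨C₂, h2, hC₂⟩ := exists_sum_nine_pow_le hε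
  refine ⟨max C₁ C₂, h1.trans (le_max_left _ _), fun R x hR hx => ?_⟩
  have hC0 : 0 < max C₁ C₂ := by linarith [le_max_left C₁ C₂]
  have hR1 : 1 ≤ R := by
    have : (1 : ℝ) < R := by linarith [le_max_left C₁ C₂]
    exact_mod_cast this.le
  have hs := singularProd_pos hT
  have hlog : 0 < Real.log (R / max C₁ C₂) := Real.log_pos (by rwa [one_lt_div hC0])
  have hlog' : Real.log (R / max C₁ C₂) ≤ Real.log (R / C₁) := by
    refine Real.log_le_log (by positivity) ?_
    gcongr
    exact le_max_left _ _
  have hden : (162 * singularProd T / Real.log (R / max C₁ C₂) ^ 3)⁻¹ ≤ mainDenominator R := by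
    refine le_trans ?_ (hC₁ R ((le_max_left _ _).trans hR.le))
    have : (162 * singularProd T / Real.log (R / max C₁ C₂) ^ 3)⁻¹ =
        (singularProd T)⁻¹ / 162 * Real.log (R / max C₁ C₂) ^ 3 := by
      field_simp
    rw [this]
    exact mul_le_mul_of_nonneg_left (pow_le_pow_left₀ hlog.le hlog' 3) (by positivity)
  have hset : {n : ℕ | (n : ℝ) ≤ x} = {n | n ≤ ⌊x⌋₊} := by
    ext n
    exact (Nat.le_floor_iff hx).symm
  have hM : ((⌊x⌋₊ / 6 + 1 : ℕ) : ℝ) ≤ x / 6 + 1 := by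
    push_cast
    have : ((⌊x⌋₊ / 6 : ℕ) : ℝ) ≤ (⌊x⌋₊ : ℝ) / 6 := Nat.cast_div_le
    have := Nat.floor_le hx
    linarith
  have hdenpos : 0 < mainDenominator R := lt_of_lt_of_le (by positivity) hden
  rw [hset]
  refine (Nat.cast_le.2 (ncard_Abar_inter_le ⌊x⌋₊ R)).trans ?_
  push_cast
  gcongr ?_ + _
  refine (card_coprime_tripleProd_le _ hR1).trans ?_
  gcongr ?_ + ?_
  · rw [div_eq_mul_inv]
    gcongr
    exact inv_le_of_inv_le₀ (by positivity) hden
  · gcongr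
    refine (hC₂ R).trans ?_
    gcongr
    exact le_max_right _ _

theorem natLog_floor_le {x : ℝ} (hx : 8 ≤ x) :
    ((Nat.log 2 (⌊x⌋₊ + 1) + 1 : ℕ) : ℝ) ≤ 4 * Real.log x := by
  have h1 : (2 : ℝ) ^ Nat.log 2 (⌊x⌋₊ + 1) ≤ 2 * x := by
    have h := Nat.pow_log_le_self 2 (show ⌊x⌋₊ + 1 ≠ 0 by omega)
    have h' : (2 : ℝ) ^ Nat.log 2 (⌊x⌋₊ + 1) ≤ ⌊x⌋₊ + 1 := by exact_mod_cast h
    have := Nat.floor_le (show 0 ≤ x by linarith)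
    linarith
  have h2 := Real.log_le_log (by positivity) h1
  rw [Real.log_pow, Real.log_mul (by norm_num) (by linarith)] at h2
  have h3 := Real.log_two_gt_d9
  have h4 : 3 * Real.log 2 ≤ Real.log x := by
    rw [show 3 * Real.log 2 = Real.log 8 by
      rw [show (8 : ℝ) = 2 ^ 3 by norm_num, Real.log_pow]; norm_num]
    exact Real.log_le_log (by norm_num) hx
  push_cast
  nlinarith

theorem exists_normalizedCount_le {T : Finset ℕ} (hT : ∀ p ∈ T, p.Prime ∧ 5 ≤ p) {θ ε : ℝ}
    (hθ : 0 < θ) (hε : 0 < ε) :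
    ∃ C c : ℝ, ∀ᶠ x : ℝ in atTop, normalizedCount x ≤
      162 * singularProd T * (1 / 6 + x⁻¹) * (Real.log x / (θ * Real.log x - c)) ^ 3 +
        C * (Real.log x ^ 3 * x ^ (-(1 - 2 * (θ * (1 + ε))))) +
        384 * (Real.log x ^ 6 * x ^ (-(1 - θ))) := by
  obtain ⟨C, hC1, hC⟩ := exists_ncard_Abar_le hT hε
  have hC0 : 0 < C := by linarith
  refine ⟨C ^ 2, Real.log (2 * C), ?_⟩
  filter_upwards [eventually_ge_atTop 8,
    (tendsto_rpow_atTop hθ).eventually_gt_atTop (2 * C)] with x hx hxC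
  set R := ⌊x ^ θ⌋₊
  have hx0 : 0 < x := by linarith
  have hs := singularProd_pos hT
  have hRle : (R : ℝ) ≤ x ^ θ := Nat.floor_le (by positivity)
  have hRge : x ^ θ / 2 ≤ R := by
    have := Nat.lt_floor_add_one (x ^ θ)
    have h2 : (2 : ℝ) ≤ x ^ θ := by linarith
    have : (1 : ℝ) ≤ R := by
      exact_mod_cast Nat.le_floor (show ((1 : ℕ) : ℝ) ≤ x ^ θ by push_cast; linarith)
    linarith
  have hl : 0 < Real.log x := Real.log_pos (by linarith)
  have hd : 0 < θ * Real.log x - Real.log (2 * C) := by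
    have := Real.log_lt_log (by linarith) hxC
    rw [Real.log_rpow hx0] at this
    linarith
  have hlog : θ * Real.log x - Real.log (2 * C) ≤ Real.log (R / C) := by
    rw [← Real.log_rpow hx0, ← Real.log_div (by positivity) (by positivity)]
    refine Real.log_le_log (by positivity) ?_
    rw [← div_div]
    gcongr
  have h := hC R x (by linarith) hx0.le
  rw [normalizedCount, div_div_eq_mul_div, div_le_iff₀ hx0]
  have hA : (x / 6 + 1) * (162 * singularProd T / Real.log (R / C) ^ 3) ≤
      (x / 6 + 1) * (162 * singularProd T / (θ * Real.log x - Real.log (2 * C)) ^ 3) := by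
    gcongr
  have hB : (C * (R : ℝ) ^ (1 + ε)) ^ 2 ≤ C ^ 2 * x ^ (2 * (θ * (1 + ε))) := by
    rw [mul_pow, mul_comm 2, Real.rpow_mul hx0.le, Real.rpow_mul hx0.le, Real.rpow_two]
    gcongr
  have hD : 3 * (((R : ℝ) + 1) * (Nat.log 2 (⌊x⌋₊ + 1) + 1 : ℕ) ^ 3) ≤
      384 * Real.log x ^ 3 * x ^ θ := by
    have h1 : (R : ℝ) + 1 ≤ 2 * x ^ θ := by linarith
    calc 3 * (((R : ℝ) + 1) * (Nat.log 2 (⌊x⌋₊ + 1) + 1 : ℕ) ^ 3)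
        ≤ 3 * ((2 * x ^ θ) * (4 * Real.log x) ^ 3) := by
          gcongr
          exact natLog_floor_le hx
      _ = 384 * Real.log x ^ 3 * x ^ θ := by ring
  have e1 : x ^ (-(1 - 2 * (θ * (1 + ε)))) * x = x ^ (2 * (θ * (1 + ε))) := by
    rw [← Real.rpow_add_one hx0.ne']
    congr 1
    ring
  have e2 : x ^ (-(1 - θ)) * x = x ^ θ := by
    rw [← Real.rpow_add_one hx0.ne']
    congr 1
    ring
  calc ((Abar ∩ {n : ℕ | (n : ℝ) ≤ x}).ncard : ℝ) * Real.log x ^ 3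
      ≤ ((x / 6 + 1) * (162 * singularProd T / (θ * Real.log x - Real.log (2 * C)) ^ 3) +
          C ^ 2 * x ^ (2 * (θ * (1 + ε))) + 384 * Real.log x ^ 3 * x ^ θ) * Real.log x ^ 3 := by
        gcongr
        linarith
    _ = _ := by
        rw [← e1, ← e2]
        field_simp

theorem limsup_normalizedCount_le_of_lt {T : Finset ℕ} (hT : ∀ p ∈ T, p.Prime ∧ 5 ≤ p) {θ : ℝ}
    (hθ : 0 < θ) (hθ2 : θ < 1 / 2) :
    limsup normalizedCount atTop ≤ 27 * singularProd T * θ⁻¹ ^ 3 := by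
  have hε : 0 < (1 - 2 * θ) / (4 * θ) := div_pos (by linarith) (by linarith)
  obtain ⟨C, c, h⟩ := exists_normalizedCount_le hT hθ hε
  have hexp : 0 < 1 - 2 * (θ * (1 + (1 - 2 * θ) / (4 * θ))) := by
    have : θ * ((1 - 2 * θ) / (4 * θ)) = (1 - 2 * θ) / 4 := by field_simp
    linarith
  have hlim : Tendsto (fun x : ℝ =>
      162 * singularProd T * (1 / 6 + x⁻¹) * (Real.log x / (θ * Real.log x - c)) ^ 3 +
        C * (Real.log x ^ 3 * x ^ (-(1 - 2 * (θ * (1 + (1 - 2 * θ) / (4 * θ)))))) +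
        384 * (Real.log x ^ 6 * x ^ (-(1 - θ)))) atTop
      (𝓝 (162 * singularProd T * (1 / 6 + 0) * θ⁻¹ ^ 3 + C * 0 + 384 * 0)) := by
    refine Tendsto.add (Tendsto.add ?_ ?_) ?_
    · exact ((tendsto_inv_atTop_zero.const_add _).const_mul _).mul
        ((tendsto_log_div c hθ).pow 3)
    · exact (tendsto_log_pow_mul_rpow_neg 3 hexp).const_mul _
    · exact (tendsto_log_pow_mul_rpow_neg 6 (by linarith)).const_mul _
  have hnonneg : ∀ᶠ x in atTop, 0 ≤ normalizedCount x := by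
    filter_upwards [eventually_ge_atTop 1] with x hx
    have := Real.log_nonneg hx
    rw [normalizedCount]
    positivity
  calc limsup normalizedCount atTop
      ≤ _ := limsup_le_limsup h (isCoboundedUnder_le_of_eventually_le atTop hnonneg)
        hlim.isBoundedUnder_le
    _ = _ := hlim.limsup_eq
    _ = _ := by ring

theorem limsup_normalizedCount_le {T : Finset ℕ} (hT : ∀ p ∈ T, p.Prime ∧ 5 ≤ p) :
    limsup normalizedCount atTop ≤ 216 * singularProd T := by
  have hlim : Tendsto (fun θ : ℝ => 27 * singularProd T * θ⁻¹ ^ 3) (𝓝[<] (1 / 2))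
      (𝓝 (27 * singularProd T * (1 / 2 : ℝ)⁻¹ ^ 3)) := by
    refine Tendsto.mono_left ?_ nhdsWithin_le_nhds
    exact ((tendsto_inv₀ (by norm_num)).pow 3).const_mul _
  have h := ge_of_tendsto hlim (b := limsup normalizedCount atTop) ?_
  · linarith
  · filter_upwards [Ioo_mem_nhdsLT (show (0 : ℝ) < 1 / 2 by norm_num)] with θ hθ
    exact limsup_normalizedCount_le_of_lt hT hθ.1 hθ.2

end AbarSieve

theorem limsup_Abar_le :
    Filter.limsup
      (fun x : ℝ => ((Abar ∩ {n : ℕ | (n : ℝ) ≤ x}).ncard : ℝ) / (x / (Real.log x) ^ 3))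
      Filter.atTop ≤ 24 * SA := by
  change Filter.limsup AbarSieve.normalizedCount Filter.atTop ≤ _
  have h : Filter.limsup AbarSieve.normalizedCount Filter.atTop / 216 ≤
      ⨅ T : Finset {p : ℕ // p.Prime ∧ 5 ≤ p},
        AbarSieve.singularProd (T.map (Function.Embedding.subtype _)) := by
    refine le_ciInf fun T => ?_
    have := AbarSieve.limsup_normalizedCount_le
      (T := T.map (Function.Embedding.subtype _)) fun p hp => by
        obtain ⟨q, _, rfl⟩ := Finset.mem_map.1 hp
        exact q.2
    linarith
  rw [AbarSieve.SA_eq_iInf]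
  linarith
end

section
/- The set A of primes satisfies limsup_{x→∞} |A_{≤x}| / (x/(log x)³) ≤ 24·𝔖_A. -/
/-- `A` is the set of primes `p` with `p ≡ 2 (mod 3)` such that there exist
`α, β, γ ≥ 1` and primes `q, r`, both coprime to `6`, with
`p + 1 = 2^α * 3^β * q` and `p - 1 = 2^γ * r`. -/
def A : Set ℕ :=
  {p | p.Prime ∧ p % 3 = 2 ∧ ∃ α β γ q r : ℕ,
    1 ≤ α ∧ 1 ≤ β ∧ 1 ≤ γ ∧
    q.Prime ∧ r.Prime ∧ Nat.Coprime q 6 ∧ Nat.Coprime r 6 ∧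
    p + 1 = 2 ^ α * 3 ^ β * q ∧ p - 1 = 2 ^ γ * r}

namespace BoundingSieve

open Finset Nat ArithmeticFunction
open scoped ArithmeticFunction.Moebius

variable (s : BoundingSieve) (N : ℕ)

/-- The divisors of the sifting modulus that do not exceed `N`. -/
def boundedDivisors : Finset ℕ := {d ∈ s.prodPrimes.divisors | d ≤ N}

/-- The sum of the Selberg terms over the divisors not exceeding `N`. -/
noncomputable def selbergSum : ℝ := ∑ l ∈ s.boundedDivisors N, s.selbergTerms l

/-- Selberg's weights, supported on the divisors not exceeding `N`. -/
noncomputable def selbergWeight (d : ℕ) : ℝ :=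
  (s.nu d)⁻¹ * μ d * (∑ m ∈ s.boundedDivisors N with d ∣ m, s.selbergTerms m) / s.selbergSum N

variable {s N}

theorem mem_boundedDivisors {d : ℕ} : d ∈ s.boundedDivisors N ↔ d ∣ s.prodPrimes ∧ d ≤ N := by
  simp [boundedDivisors, s.prodPrimes_ne_zero]

theorem mem_boundedDivisors_of_dvd {d m : ℕ} (hdm : d ∣ m) (hm : m ∈ s.boundedDivisors N) :
    d ∈ s.boundedDivisors N := by
  rw [mem_boundedDivisors] at hm ⊢
  have hm0 : 0 < m := Nat.pos_of_dvd_of_pos hm.1 (Nat.pos_of_ne_zero s.prodPrimes_ne_zero)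
  exact ⟨hdm.trans hm.1, (Nat.le_of_dvd hm0 hdm).trans hm.2⟩

theorem selbergTerms_pos_of_mem {d : ℕ} (hd : d ∈ s.boundedDivisors N) :
    0 < s.selbergTerms d :=
  selbergTerms_pos (mem_boundedDivisors.1 hd).1

theorem selbergSum_pos (hN : 1 ≤ N) : 0 < s.selbergSum N :=
  sum_pos (fun _ hd ↦ selbergTerms_pos_of_mem hd)
    ⟨1, mem_boundedDivisors.2 ⟨one_dvd _, hN⟩⟩

theorem selbergWeight_one (hN : 1 ≤ N) : s.selbergWeight N 1 = 1 := by
  have h := (selbergSum_pos (s := s) hN).ne'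
  simp only [selbergWeight, one_dvd, filter_true, s.nu_mult.map_one]
  change (1 : ℝ)⁻¹ * ((μ 1 : ℤ) : ℝ) * s.selbergSum N / s.selbergSum N = 1
  simp [h]

theorem selbergWeight_eq_zero {d : ℕ} (hd : d ∉ s.boundedDivisors N) :
    s.selbergWeight N d = 0 := by
  rw [selbergWeight, filter_false_of_mem]
  · simp
  · exact fun m hm hdm ↦ hd (mem_boundedDivisors_of_dvd hdm hm)

theorem abs_selbergWeight_le (hN : 1 ≤ N) {d : ℕ} (hd : d ∣ s.prodPrimes) :
    |s.selbergWeight N d| ≤ ∏ p ∈ d.primeFactors, (1 - s.nu p)⁻¹ := by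
  have hG := selbergSum_pos (s := s) hN
  have hnu := nu_pos_of_dvd_prodPrimes hd
  have hd0 : d ≠ 0 := ne_zero_of_dvd_ne_zero s.prodPrimes_ne_zero hd
  have hsum : ∑ m ∈ s.boundedDivisors N with d ∣ m, s.selbergTerms m ≤
      s.selbergTerms d * s.selbergSum N := by
    rw [selbergSum, mul_sum]
    calc _ = ∑ m ∈ s.boundedDivisors N with d ∣ m, s.selbergTerms d * s.selbergTerms (m / d) := by
          refine sum_congr rfl fun m hm ↦ ?_
          obtain ⟨hm, e, rfl⟩ := mem_filter.1 hm
          rw [Nat.mul_div_cancel_left _ (Nat.pos_of_ne_zero hd0)]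
          refine selbergTerms_isMultiplicative.map_mul_of_coprime ?_
          exact coprime_of_squarefree_mul
            (squarefree_of_dvd_prodPrimes (mem_boundedDivisors.1 hm).1)
      _ = ∑ m ∈ ({m ∈ s.boundedDivisors N | d ∣ m}).image (· / d),
            s.selbergTerms d * s.selbergTerms m := by
          rw [sum_image]
          intro a ha b hb hab
          exact Nat.div_left_inj (mem_filter.1 ha).2 (mem_filter.1 hb).2 |>.1 hab
      _ ≤ _ := by
          refine sum_le_sum_of_subset_of_nonneg ?_ fun m hm _ ↦
            (mul_pos (selbergTerms_pos hd) (selbergTerms_pos_of_mem hm)).le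
          intro m hm
          obtain ⟨e, he, rfl⟩ := mem_image.1 hm
          exact mem_boundedDivisors_of_dvd (Nat.div_dvd_of_dvd (mem_filter.1 he).2)
            (mem_filter.1 he).1
  have hμ : |((μ d : ℤ) : ℝ)| ≤ 1 := by exact_mod_cast abs_moebius_le_one
  have hnonneg : 0 ≤ ∑ m ∈ s.boundedDivisors N with d ∣ m, s.selbergTerms m :=
    sum_nonneg fun m hm ↦ (selbergTerms_pos_of_mem (mem_filter.1 hm).1).le
  rw [selbergWeight, abs_div, abs_mul, abs_mul, abs_of_pos (inv_pos.2 hnu), abs_of_nonneg hnonneg,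
    abs_of_pos hG, div_le_iff₀ hG]
  calc _ ≤ (s.nu d)⁻¹ * 1 * (s.selbergTerms d * s.selbergSum N) := by gcongr
    _ = _ := by
      rw [selbergTerms_apply]
      field_simp

theorem sum_nu_mul_selbergWeight {l : ℕ} :
    (∑ d ∈ s.prodPrimes.divisors, if l ∣ d then s.nu d * s.selbergWeight N d else 0) =
      if l ∈ s.boundedDivisors N then μ l * s.selbergTerms l / s.selbergSum N else 0 := by
  have hinner : ∀ m ∈ s.boundedDivisors N,
      (∑ d ∈ s.prodPrimes.divisors, if l ∣ d ∧ d ∣ m then ((μ d : ℤ) : ℝ) else 0) =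
        if m = l then ((μ l : ℤ) : ℝ) else 0 := by
    intro m hm
    have hmP := (mem_boundedDivisors.1 hm).1
    have hm0 := ne_zero_of_dvd_ne_zero s.prodPrimes_ne_zero hmP
    by_cases hlm : l ∣ m
    · obtain ⟨e, rfl⟩ := hlm
      have hl0 : l ≠ 0 := left_ne_zero_of_mul hm0
      have he0 : e ≠ 0 := right_ne_zero_of_mul hm0
      have hsq := squarefree_of_dvd_prodPrimes hmP
      rw [← sum_filter]
      have : ({d ∈ s.prodPrimes.divisors | l ∣ d ∧ d ∣ l * e}) =
          e.divisors.image (l * ·) := by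
        ext d
        simp only [mem_filter, Nat.mem_divisors, mem_image]
        constructor
        · rintro ⟨-, ⟨c, rfl⟩, h⟩
          exact ⟨c, ⟨Nat.dvd_of_mul_dvd_mul_left (Nat.pos_of_ne_zero hl0) h, he0⟩, rfl⟩
        · rintro ⟨c, ⟨hc, -⟩, rfl⟩
          have := Nat.mul_dvd_mul_left l hc
          exact ⟨⟨this.trans hmP, s.prodPrimes_ne_zero⟩, dvd_mul_right _ _, this⟩
      rw [this, sum_image fun a _ b _ h ↦ Nat.eq_of_mul_eq_mul_left (Nat.pos_of_ne_zero hl0) h]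
      have hstep : ∀ c ∈ e.divisors, ((μ (l * c) : ℤ) : ℝ) = μ l * μ c := by
        intro c hc
        have hlc : l.Coprime c := (coprime_of_squarefree_mul hsq).coprime_dvd_right
          (Nat.dvd_of_mem_divisors hc)
        rw [isMultiplicative_moebius.map_mul_of_coprime hlc]
        push_cast
        rfl
      rw [sum_congr rfl hstep, ← mul_sum]
      have hsum : (∑ c ∈ e.divisors, ((μ c : ℤ) : ℝ)) = if e = 1 then 1 else 0 := by
        have := congrArg (fun f : ArithmeticFunction ℤ ↦ f e) moebius_mul_coe_zeta
        simp only [coe_mul_zeta_apply, one_apply] at this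
        exact_mod_cast this
      rw [hsum]
      by_cases he : e = 1
      · simp [he]
      · simp [he, hl0]
    · rw [if_neg fun h : m = l ↦ hlm h.symm.dvd]
      exact sum_eq_zero fun d _ ↦ if_neg fun h ↦ hlm (h.1.trans h.2)
  calc _ = ∑ d ∈ s.prodPrimes.divisors, ∑ m ∈ s.boundedDivisors N,
        s.selbergTerms m / s.selbergSum N * if l ∣ d ∧ d ∣ m then ((μ d : ℤ) : ℝ) else 0 := by
        refine sum_congr rfl fun d hd ↦ ?_
        have hnu := nu_ne_zero (s := s) (Nat.dvd_of_mem_divisors hd)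
        split_ifs with hld
        · simp only [hld, true_and, mul_ite, mul_zero, ← sum_filter]
          rw [selbergWeight, ← sum_mul, ← sum_div]
          field_simp
        · simp [hld]
    _ = ∑ m ∈ s.boundedDivisors N, s.selbergTerms m / s.selbergSum N *
          if m = l then ((μ l : ℤ) : ℝ) else 0 := by
        rw [sum_comm]
        refine sum_congr rfl fun m hm ↦ ?_
        rw [← mul_sum, hinner m hm]
    _ = _ := by
        simp only [mul_ite, mul_zero, sum_ite_eq']
        split_ifs <;> ring

theorem mainSum_selbergWeight (hN : 1 ≤ N) :
    s.mainSum (lambdaSquared (s.selbergWeight N)) = (s.selbergSum N)⁻¹ := by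
  have hG := (selbergSum_pos (s := s) hN).ne'
  rw [mainSum_lambdaSquared_eq_sum_mul_sum_sq]
  calc _ = ∑ l ∈ s.prodPrimes.divisors, if l ≤ N then
        s.selbergTerms l / s.selbergSum N ^ 2 else 0 := by
        refine sum_congr rfl fun l hl ↦ ?_
        have hlP := Nat.dvd_of_mem_divisors hl
        rw [sum_nu_mul_selbergWeight]
        simp only [mem_boundedDivisors, hlP, true_and]
        split_ifs
        · have hh := (selbergTerms_pos (s := s) hlP).ne'
          have hμ : ((μ l : ℤ) : ℝ) ^ 2 = 1 := by
            exact_mod_cast moebius_sq_eq_one_of_squarefree (squarefree_of_dvd_prodPrimes hlP)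
          rw [div_pow, mul_pow, hμ]
          field_simp
        · simp
    _ = _ := by
        rw [← sum_filter, ← sum_div]
        change s.selbergSum N / s.selbergSum N ^ 2 = _
        field_simp

theorem errSum_selbergWeight_le :
    s.errSum (lambdaSquared (s.selbergWeight N)) ≤
      ∑ d₁ ∈ s.boundedDivisors N, ∑ d₂ ∈ s.boundedDivisors N,
        |s.selbergWeight N d₁| * |s.selbergWeight N d₂| * |s.rem (d₁.lcm d₂)| := by
  set w := s.selbergWeight N with hw
  set D := s.boundedDivisors N with hD
  have hsub : ∀ d ∈ s.prodPrimes.divisors, |lambdaSquared w d| ≤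
      ∑ d₁ ∈ D, ∑ d₂ ∈ D, if d = d₁.lcm d₂ then |w d₁| * |w d₂| else 0 := by
    intro d hd
    have hd0 := (Nat.pos_of_mem_divisors hd).ne'
    calc _ ≤ ∑ d₁ ∈ d.divisors, ∑ d₂ ∈ d.divisors,
          if d = d₁.lcm d₂ then |w d₁| * |w d₂| else 0 := by
          refine (abs_sum_le_sum_abs _ _).trans (sum_le_sum fun d₁ _ ↦ ?_)
          refine (abs_sum_le_sum_abs _ _).trans (sum_le_sum fun d₂ _ ↦ ?_)
          split_ifs
          · rw [abs_mul]
          · simp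
      _ = ∑ d₁ ∈ d.divisors with d₁ ∈ D, ∑ d₂ ∈ d.divisors with d₂ ∈ D,
          if d = d₁.lcm d₂ then |w d₁| * |w d₂| else 0 := by
          rw [sum_filter]
          refine sum_congr rfl fun d₁ _ ↦ ?_
          split_ifs with h₁
          · rw [sum_filter]
            refine sum_congr rfl fun d₂ _ ↦ ?_
            by_cases h₂ : d₂ ∈ D
            · simp [h₂]
            · simp [h₂, hw, selbergWeight_eq_zero h₂]
          · simp [hw, selbergWeight_eq_zero h₁]
      _ ≤ ∑ d₁ ∈ d.divisors with d₁ ∈ D, ∑ d₂ ∈ D,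
          if d = d₁.lcm d₂ then |w d₁| * |w d₂| else 0 := by
          refine sum_le_sum fun d₁ _ ↦ sum_le_sum_of_subset_of_nonneg ?_ fun _ _ _ ↦ ?_
          · exact fun x hx ↦ (mem_filter.1 hx).2
          · positivity
      _ ≤ _ := by
          refine sum_le_sum_of_subset_of_nonneg ?_ fun _ _ _ ↦ ?_
          · exact fun x hx ↦ (mem_filter.1 hx).2
          · positivity
  calc _ ≤ ∑ d ∈ s.prodPrimes.divisors,
        (∑ d₁ ∈ D, ∑ d₂ ∈ D, if d = d₁.lcm d₂ then |w d₁| * |w d₂| else 0) * |s.rem d| :=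
        sum_le_sum fun d hd ↦ mul_le_mul_of_nonneg_right (hsub d hd) (abs_nonneg _)
    _ = ∑ d₁ ∈ D, ∑ d₂ ∈ D, ∑ d ∈ s.prodPrimes.divisors,
          if d = d₁.lcm d₂ then |w d₁| * |w d₂| * |s.rem d| else 0 := by
        simp_rw [sum_mul, ite_mul, zero_mul]
        rw [sum_comm]
        exact sum_congr rfl fun _ _ ↦ sum_comm
    _ = _ := by
        refine sum_congr rfl fun d₁ h₁ ↦ sum_congr rfl fun d₂ h₂ ↦ ?_
        rw [sum_ite_eq' _ _ fun d ↦ |w d₁| * |w d₂| * |s.rem d|, if_pos]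
        exact Nat.mem_divisors.2 ⟨Nat.lcm_dvd (mem_boundedDivisors.1 h₁).1
          (mem_boundedDivisors.1 h₂).1, s.prodPrimes_ne_zero⟩

/-- The Selberg upper bound sieve. -/
theorem siftedSum_le_selberg (hN : 1 ≤ N) :
    s.siftedSum ≤ s.totalMass / s.selbergSum N +
      ∑ d₁ ∈ s.boundedDivisors N, ∑ d₂ ∈ s.boundedDivisors N,
        |s.selbergWeight N d₁| * |s.selbergWeight N d₂| * |s.rem (d₁.lcm d₂)| := by
  refine (siftedSum_le_mainSum_errSum_of_upperMoebius _
    (upperMoebius_lambdaSquared _ (selbergWeight_one (s := s) hN))).trans ?_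
  rw [mainSum_selbergWeight hN, ← div_eq_mul_inv]
  gcongr
  exact errSum_selbergWeight_le

end BoundingSieve

namespace RoughSum

open Finset ArithmeticFunction Real
open scoped ArithmeticFunction.Omega Real

theorem sum_divisors_pow_cardFactors_le (k : ℕ) {n : ℕ} (hn : n ≠ 0) :
    ∑ a ∈ n.divisors, k ^ Ω a ≤ (k + 1) ^ Ω n := by
  induction n using induction_on_primes with
  | zero => exact absurd rfl hn
  | one => simp
  | prime_mul p m hp ih =>
    have hm : m ≠ 0 := right_ne_zero_of_mul hn
    have hsub : (p * m).divisors ⊆ m.divisors ∪ m.divisors.image (p * ·) := by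
      intro a ha
      rw [Nat.divisors_mul, Finset.mem_mul] at ha
      obtain ⟨b, hb, c, hc, rfl⟩ := ha
      rcases (Nat.dvd_prime hp).1 (Nat.dvd_of_mem_divisors hb) with rfl | rfl
      · simpa using Or.inl hc
      · exact mem_union_right _ (mem_image_of_mem _ hc)
    calc _ ≤ ∑ a ∈ m.divisors ∪ m.divisors.image (p * ·), k ^ Ω a := sum_le_sum_of_subset hsub
      _ ≤ ∑ a ∈ m.divisors, k ^ Ω a + ∑ a ∈ m.divisors.image (p * ·), k ^ Ω a := by
        rw [← sum_union_inter]; exact Nat.le_add_right _ _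
      _ = ∑ a ∈ m.divisors, k ^ Ω a + ∑ a ∈ m.divisors, k * k ^ Ω a := by
        rw [sum_image fun a _ b _ h ↦ Nat.eq_of_mul_eq_mul_left hp.pos h]
        congr 1
        refine sum_congr rfl fun a ha ↦ ?_
        rw [cardFactors_mul hp.ne_zero (Nat.pos_of_mem_divisors ha).ne',
          cardFactors_apply_prime hp, pow_add, pow_one]
      _ = (k + 1) * ∑ a ∈ m.divisors, k ^ Ω a := by rw [← mul_sum]; ring
      _ ≤ (k + 1) * (k + 1) ^ Ω m := Nat.mul_le_mul_left _ (ih hm)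
      _ = _ := by
        rw [cardFactors_mul hp.ne_zero hm, cardFactors_apply_prime hp, pow_add, pow_one]

/-- The function `n ↦ k ^ Ω(n) / n`, restricted to `n` coprime to `Q`. -/
noncomputable def term (k Q : ℕ) : ArithmeticFunction ℝ :=
  ⟨fun n ↦ if Q.Coprime n then (k : ℝ) ^ Ω n / n else 0, by simp⟩

theorem term_apply (k Q n : ℕ) : term k Q n = if Q.Coprime n then (k : ℝ) ^ Ω n / n else 0 := rfl

theorem term_nonneg (k Q n : ℕ) : 0 ≤ term k Q n := by
  rw [term_apply]; positivity

theorem term_one_mul_term_le (k Q n : ℕ) : (term 1 Q * term k Q) n ≤ term (k + 1) Q n := by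
  rcases eq_or_ne n 0 with rfl | hn
  · simp
  rw [mul_apply]
  by_cases hQ : Q.Coprime n
  · have : ∀ x ∈ n.divisorsAntidiagonal, term 1 Q x.1 * term k Q x.2 = (k : ℝ) ^ Ω x.2 / n := by
      rintro ⟨a, b⟩ hx
      obtain ⟨rfl, -⟩ := Nat.mem_divisorsAntidiagonal.1 hx
      rw [Nat.coprime_mul_iff_right] at hQ
      simp only [term_apply, if_pos hQ.1, if_pos hQ.2]
      push_cast
      rw [one_pow, div_mul_div_comm, one_mul]
    rw [sum_congr rfl this, Nat.sum_divisorsAntidiagonal' fun _ b ↦ (k : ℝ) ^ Ω b / n, ← sum_div,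
      term_apply, if_pos hQ]
    gcongr
    exact_mod_cast sum_divisors_pow_cardFactors_le k hn
  · rw [term_apply, if_neg hQ]
    refine (sum_eq_zero ?_).le
    rintro ⟨a, b⟩ hx
    obtain ⟨rfl, -⟩ := Nat.mem_divisorsAntidiagonal.1 hx
    rw [Nat.coprime_mul_iff_right, not_and_or] at hQ
    rcases hQ with h | h <;> simp [term_apply, h]

theorem sum_sum_term_le (k Q M : ℕ) :
    ∑ a ∈ Ioc 0 M, term 1 Q a * ∑ b ∈ Ioc 0 (M / a), term k Q b ≤
      ∑ n ∈ Ioc 0 M, term (k + 1) Q n := by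
  rw [← sum_Ioc_mul_eq_sum_sum]
  exact sum_le_sum fun n _ ↦ term_one_mul_term_le k Q n

theorem sum_term_one_mul_ge {Q : ℕ} (hQ : Q ≠ 0) {F : ℕ → ℝ} (hF : ∀ n, 0 ≤ F n)
    (hanti : ∀ m n, 0 < m → m ≤ n → F n ≤ F m) (J : ℕ) :
    (Q.totient / Q : ℝ) * ∑ j ∈ Ioc 0 J, (1 / j : ℝ) * F (j * Q) ≤
      ∑ n ∈ Ioc 0 (J * Q), term 1 Q n * F n := by
  have hQ0 : 0 < Q := Nat.pos_of_ne_zero hQ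
  induction J with
  | zero => simp
  | succ J ih =>
    have h₁ : Ioc 0 ((J + 1) * Q) = Ioc 0 (J * Q) ∪ Ioc (J * Q) ((J + 1) * Q) :=
      (Ioc_union_Ioc_eq_Ioc (Nat.zero_le _) (by gcongr; omega)).symm
    have h₂ : Disjoint (Ioc 0 (J * Q)) (Ioc (J * Q) ((J + 1) * Q)) :=
      disjoint_left.2 fun x hx hx' ↦ by
        rw [mem_Ioc] at hx hx'; omega
    rw [h₁, sum_union h₂, ← insert_Ioc_right_eq_Ioc_add_one (Nat.zero_le J),
      sum_insert (by simp), mul_add, add_comm]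
    refine add_le_add ih ?_
    have h₃ : Ioc (J * Q) ((J + 1) * Q) = Ico (J * Q + 1) (J * Q + 1 + Q) := by
      ext x; rw [mem_Ioc, mem_Ico, add_mul]; omega
    have hterm : ∀ n ∈ Ico (J * Q + 1) (J * Q + 1 + Q),
        (if Q.Coprime n then (1 / ((J + 1) * Q) : ℝ) * F ((J + 1) * Q) else 0) ≤
          term 1 Q n * F n := by
      intro n hn
      rw [mem_Ico] at hn
      rw [term_apply]
      split_ifs
      · have hn0 : (0 : ℝ) < n := by exact_mod_cast (by omega : 0 < n)
        have hle : n ≤ (J + 1) * Q := by rw [add_mul]; omega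
        have hle' : (n : ℝ) ≤ (J + 1) * Q := by exact_mod_cast hle
        simp only [Nat.cast_one, one_pow]
        gcongr
        · exact hF _
        · exact hanti _ _ (by omega) hle
      · simp
    rw [h₃]
    refine le_trans (le_of_eq ?_) (sum_le_sum hterm)
    rw [← sum_filter, sum_const, Nat.filter_coprime_Ico_eq_totient, nsmul_eq_mul]
    have : (0 : ℝ) < Q := by exact_mod_cast hQ0
    push_cast
    field_simp

theorem sum_posLog_pow_ge {y : ℝ} (hy : 0 < y) (k J : ℕ) :
    (log⁺ y ^ (k + 1) - log⁺ (y / (J + 1)) ^ (k + 1)) / (k + 1) ≤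
      ∑ j ∈ Ioc 0 J, (1 / j : ℝ) * log⁺ (y / j) ^ k := by
  induction J with
  | zero => simp
  | succ J ih =>
    rw [← insert_Ioc_right_eq_Ioc_add_one (Nat.zero_le J), sum_insert (by simp)]
    set a := log⁺ (y / (J + 1)) with ha
    set b := log⁺ (y / ((J + 1 : ℕ) + 1)) with hb
    have hJ : (0 : ℝ) < (J : ℝ) + 1 := by positivity
    have hba : b ≤ a := by
      apply posLog_le_posLog (by positivity)
      push_cast
      gcongr
      linarith
    have hb0 : 0 ≤ b := posLog_nonneg
    have hab : a - b ≤ 1 / (J + 1) := by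
      have h₁ : y / ((J : ℝ) + 1) = y / ((J + 1 : ℕ) + 1) * (((J : ℝ) + 1 + 1) / (J + 1)) := by
        push_cast; field_simp
      have h₂ : log⁺ (((J : ℝ) + 1 + 1) / (J + 1)) ≤ 1 / (J + 1) := by
        have h1le : 1 ≤ ((J : ℝ) + 1 + 1) / (J + 1) := by
          rw [le_div_iff₀ hJ]; linarith
        rw [posLog_eq_log (by rwa [abs_of_pos (by positivity)])]
        refine (log_le_sub_one_of_pos (by positivity)).trans (le_of_eq ?_)
        field_simp
        ring
      have h₃ : a ≤ b + log⁺ (((J : ℝ) + 1 + 1) / (J + 1)) := by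
        rw [ha, h₁]; exact posLog_mul
      linarith
    have hpow : a ^ (k + 1) - b ^ (k + 1) ≤ (k + 1) * (1 / (J + 1) * a ^ k) := by
      have h := (le_abs_self _).trans (abs_pow_sub_pow_le a b (k + 1))
      rw [abs_of_nonneg (sub_nonneg.2 hba), abs_of_nonneg hb0, abs_of_nonneg (hb0.trans hba),
        max_eq_left hba, Nat.add_sub_cancel] at h
      have ha0 : 0 ≤ a ^ k := pow_nonneg (hb0.trans hba) k
      push_cast at h
      calc _ ≤ _ := h
        _ ≤ 1 / (J + 1) * (k + 1) * a ^ k := by gcongr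
        _ = _ := by ring
    have hstep : (a ^ (k + 1) - b ^ (k + 1)) / (k + 1) ≤ 1 / (J + 1) * a ^ k := by
      rw [div_le_iff₀ (by positivity)]; linarith
    calc _ = (log⁺ y ^ (k + 1) - a ^ (k + 1)) / (k + 1) +
          (a ^ (k + 1) - b ^ (k + 1)) / (k + 1) := by ring
      _ ≤ _ := by
        rw [add_comm]
        refine add_le_add ?_ ih
        push_cast
        exact hstep

theorem sum_term_ge {Q : ℕ} (hQ : Q ≠ 0) (k : ℕ) {y : ℝ} (hy : 1 ≤ y) :
    (Q.totient / Q : ℝ) ^ k / k.factorial * log⁺ (y / (Q : ℝ) ^ k) ^ k ≤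
      ∑ n ∈ Ioc 0 ⌊y⌋₊, term k Q n := by
  have hQ0 : (0 : ℝ) < Q := by exact_mod_cast Nat.pos_of_ne_zero hQ
  have hQ1 : (1 : ℝ) ≤ Q := by exact_mod_cast Nat.pos_of_ne_zero hQ
  induction k generalizing y with
  | zero =>
    have h : term 0 Q 1 ≤ ∑ n ∈ Ioc 0 ⌊y⌋₊, term 0 Q n :=
      single_le_sum (fun n _ ↦ term_nonneg 0 Q n)
        (mem_Ioc.2 ⟨one_pos, Nat.le_floor (by simpa using hy)⟩)
    simpa [term_apply] using h
  | succ k ih =>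
    have hy0 : 0 < y := by linarith
    set c : ℝ := (Q.totient / Q : ℝ) ^ k / k.factorial with hc
    have hc0 : 0 ≤ c := by positivity
    set F : ℕ → ℝ := fun n ↦ c * log⁺ (y / n / (Q : ℝ) ^ k) ^ k with hF
    have hF0 : ∀ n, 0 ≤ F n := fun n ↦ mul_nonneg hc0 (pow_nonneg posLog_nonneg _)
    have hanti : ∀ m n, 0 < m → m ≤ n → F n ≤ F m := by
      intro m n hm hmn
      have hm' : (0 : ℝ) < m := by exact_mod_cast hm
      have hmn' : (m : ℝ) ≤ n := by exact_mod_cast hmn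
      have hle : log⁺ (y / n / (Q : ℝ) ^ k) ≤ log⁺ (y / m / (Q : ℝ) ^ k) :=
        posLog_le_posLog (by positivity) (by gcongr)
      exact mul_le_mul_of_nonneg_left (pow_le_pow_left₀ posLog_nonneg hle _) hc0
    set J := ⌊y⌋₊ / Q with hJ
    have hJy : y / (Q : ℝ) ^ (k + 1) / (J + 1) ≤ 1 := by
      have h₁ : y / Q < J + 1 := by
        rw [hJ, ← Nat.floor_div_natCast]
        exact Nat.lt_floor_add_one _
      have h₂ : y / (Q : ℝ) ^ (k + 1) ≤ y / Q := by
        gcongr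
        exact le_self_pow₀ hQ1 (by omega)
      rw [div_le_one (by positivity)]
      linarith
    have hlast : log⁺ (y / (Q : ℝ) ^ (k + 1) / (J + 1)) = 0 := by
      rw [posLog_eq_zero_iff, abs_of_pos (by positivity)]
      exact hJy
    have hsum := sum_posLog_pow_ge (y := y / (Q : ℝ) ^ (k + 1)) (by positivity) k J
    rw [hlast, zero_pow (by omega), sub_zero] at hsum
    calc _ = (Q.totient / Q : ℝ) * (c * (log⁺ (y / (Q : ℝ) ^ (k + 1)) ^ (k + 1) / (k + 1))) := by
          rw [hc, Nat.factorial_succ]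
          push_cast
          generalize (Q.totient / Q : ℝ) = r
          field_simp
          ring
      _ ≤ (Q.totient / Q : ℝ) *
          (c * ∑ j ∈ Ioc 0 J, (1 / j : ℝ) * log⁺ (y / (Q : ℝ) ^ (k + 1) / j) ^ k) := by gcongr
      _ = (Q.totient / Q : ℝ) * ∑ j ∈ Ioc 0 J, (1 / j : ℝ) * F (j * Q) := by
          rw [mul_sum]
          congr 1
          refine sum_congr rfl fun j _ ↦ ?_
          have : y / ((j * Q : ℕ) : ℝ) / (Q : ℝ) ^ k = y / (Q : ℝ) ^ (k + 1) / j := by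
            rw [div_div, div_div]
            congr 1
            push_cast
            ring
          simp only [hF, this]
          ring
      _ ≤ ∑ n ∈ Ioc 0 (J * Q), term 1 Q n * F n := sum_term_one_mul_ge hQ hF0 hanti J
      _ ≤ ∑ n ∈ Ioc 0 ⌊y⌋₊, term 1 Q n * F n :=
          sum_le_sum_of_subset_of_nonneg (Ioc_subset_Ioc_right (Nat.div_mul_le_self _ _))
            fun n _ _ ↦ mul_nonneg (term_nonneg _ _ _) (hF0 n)
      _ ≤ ∑ n ∈ Ioc 0 ⌊y⌋₊, term 1 Q n * ∑ b ∈ Ioc 0 (⌊y⌋₊ / n), term k Q b := by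
          refine sum_le_sum fun n hn ↦ mul_le_mul_of_nonneg_left ?_ (term_nonneg _ _ _)
          rw [mem_Ioc] at hn
          have hn0 : (0 : ℝ) < n := by exact_mod_cast hn.1
          have hny : (n : ℝ) ≤ y := (Nat.le_floor_iff hy0.le).1 hn.2
          rw [← Nat.floor_div_natCast]
          exact ih ((one_le_div hn0).2 hny)
      _ ≤ _ := sum_sum_term_le k Q _

end RoughSum

namespace RoughSum

open Finset ArithmeticFunction
open scoped ArithmeticFunction.Omega

/-- The function `term k Q` as a completely multiplicative function. -/
noncomputable def termHom (k Q : ℕ) : ℕ →* ℝ where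
  toFun := term k Q
  map_one' := by simp [term_apply]
  map_mul' m n := by
    rcases eq_or_ne m 0 with rfl | hm
    · simp
    rcases eq_or_ne n 0 with rfl | hn
    · simp
    simp only [term_apply, Nat.coprime_mul_iff_right, cardFactors_mul hm hn]
    by_cases h₁ : Q.Coprime m
    · by_cases h₂ : Q.Coprime n
      · rw [if_pos ⟨h₁, h₂⟩, if_pos h₁, if_pos h₂, pow_add, div_mul_div_comm, Nat.cast_mul]
      · rw [if_neg fun h ↦ h₂ h.2, if_neg h₂, mul_zero]
    · rw [if_neg fun h ↦ h₁ h.1, if_neg h₁, zero_mul]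

theorem termHom_apply (k Q n : ℕ) : termHom k Q n = term k Q n := rfl

theorem termHom_prime {k Q p : ℕ} (hp : p.Prime) (hQ : Q.Coprime p) :
    termHom k Q p = k / p := by
  simp [termHom_apply, term_apply, hQ, cardFactors_apply_prime hp]

theorem termHom_squarefree {k Q d : ℕ} (hd : Squarefree d) (hQ : Q.Coprime d) :
    termHom k Q d = ∏ p ∈ d.primeFactors, (k / p : ℝ) := by
  conv_lhs => rw [← Nat.prod_primeFactors_of_squarefree hd]
  rw [map_prod]
  exact prod_congr rfl fun p hp ↦ termHom_prime (Nat.prime_of_mem_primeFactors hp)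
    (hQ.coprime_dvd_right (Nat.dvd_of_mem_primeFactors hp))

theorem sum_term_radical_le {k Q : ℕ} (hk : ∀ p : ℕ, p.Prime → Q.Coprime p → k < p) (M : ℕ)
    {d : ℕ} (hd : Squarefree d) (hQ : Q.Coprime d) :
    ∑ n ∈ Ioc 0 M with ∏ p ∈ n.primeFactors, p = d, term k Q n ≤
      ∏ p ∈ d.primeFactors, (k / (p - k) : ℝ) := by
  have hd0 : 0 < d := Nat.pos_of_ne_zero hd.ne_zero
  have hnorm : ∀ {p : ℕ}, p.Prime → ‖termHom k Q p‖ < 1 := by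
    intro p hp
    by_cases hQp : Q.Coprime p
    · have hp0 : (0 : ℝ) < p := by exact_mod_cast hp.pos
      rw [termHom_prime hp hQp, Real.norm_of_nonneg (by positivity), div_lt_one hp0]
      exact_mod_cast hk p hp hQp
    · simp [termHom_apply, term_apply, hQp]
  have hsum := (EulerProduct.summable_and_hasSum_factoredNumbers_prod_filter_prime_geometric
    hnorm d.primeFactors).2
  rw [filter_true_of_mem fun p hp ↦ Nat.prime_of_mem_primeFactors hp] at hsum
  have hsum' := hasSum_subtype_iff_indicator.1 hsum
  set T := {n ∈ Ioc 0 M | ∏ p ∈ n.primeFactors, p = d} with hT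
  have hdvd : ∀ n ∈ T, d ∣ n := fun n hn ↦
    (mem_filter.1 hn).2 ▸ Nat.prod_primeFactors_dvd n
  have hmem : ∀ m ∈ T.image (· / d), m ∈ Nat.factoredNumbers d.primeFactors := by
    intro m hm
    obtain ⟨n, hn, rfl⟩ := mem_image.1 hm
    have hn0 : n ≠ 0 := by have := mem_Ioc.1 (mem_filter.1 hn).1; omega
    have hfac : n.primeFactors = d.primeFactors := by
      rw [← (mem_filter.1 hn).2]
      exact (Nat.primeFactors_prod fun p hp ↦ Nat.prime_of_mem_primeFactors hp).symm
    refine Nat.mem_factoredNumbers_of_primeFactors_subset ?_ ?_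
    · exact (Nat.div_pos (Nat.le_of_dvd (Nat.pos_of_ne_zero hn0) (hdvd n hn)) hd0).ne'
    · rw [← hfac]
      exact Nat.primeFactors_mono (Nat.div_dvd_of_dvd (hdvd n hn)) hn0
  calc _ = ∑ n ∈ T, termHom k Q d * termHom k Q (n / d) := by
        refine sum_congr rfl fun n hn ↦ ?_
        rw [← map_mul, Nat.mul_div_cancel' (hdvd n hn), termHom_apply]
    _ = termHom k Q d * ∑ m ∈ T.image (· / d), termHom k Q m := by
        rw [← mul_sum, sum_image]
        intro a ha b hb hab
        exact (Nat.div_left_inj (hdvd a ha) (hdvd b hb)).1 hab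
    _ ≤ termHom k Q d * ∏ p ∈ d.primeFactors, (1 - termHom k Q p)⁻¹ := by
        refine mul_le_mul_of_nonneg_left ?_ (term_nonneg _ _ _)
        refine le_trans (le_of_eq ?_) (sum_le_hasSum (T.image (· / d)) ?_ hsum')
        · exact sum_congr rfl fun m hm ↦ (Set.indicator_of_mem (hmem m hm) _).symm
        · exact fun m _ ↦ Set.indicator_nonneg (fun _ _ ↦ term_nonneg _ _ _) _
    _ = _ := by
        rw [termHom_squarefree hd hQ, ← prod_mul_distrib]
        refine prod_congr rfl fun p hp ↦ ?_
        have hpp := Nat.prime_of_mem_primeFactors hp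
        have hQp := hQ.coprime_dvd_right (Nat.dvd_of_mem_primeFactors hp)
        have hp0 : (0 : ℝ) < p := by exact_mod_cast hpp.pos
        have hkp : (k : ℝ) < p := by exact_mod_cast hk p hpp hQp
        have : (p : ℝ) - k ≠ 0 := by linarith
        rw [termHom_prime hpp hQp]
        field_simp

theorem sum_term_le_sum_squarefree {k Q : ℕ} (hk : ∀ p : ℕ, p.Prime → Q.Coprime p → k < p)
    (M : ℕ) :
    ∑ n ∈ Ioc 0 M, term k Q n ≤
      ∑ d ∈ Ioc 0 M with Squarefree d ∧ Q.Coprime d,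
        ∏ p ∈ d.primeFactors, (k / (p - k) : ℝ) := by
  have hrad : ∀ n ∈ {n ∈ Ioc 0 M | Q.Coprime n},
      (∏ p ∈ n.primeFactors, p) ∈ {d ∈ Ioc 0 M | Squarefree d ∧ Q.Coprime d} := by
    intro n hn
    simp only [mem_filter, mem_Ioc] at hn ⊢
    have hdvd := Nat.prod_primeFactors_dvd n
    have hle := Nat.le_of_dvd hn.1.1 hdvd
    refine ⟨⟨Nat.pos_of_dvd_of_pos hdvd hn.1.1, hle.trans hn.1.2⟩, ?_,
      hn.2.coprime_dvd_right hdvd⟩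
    exact Finset.squarefree_prod_of_pairwise_isCoprime (fun a ha b hb hab ↦
      Nat.coprime_iff_isRelPrime.1 ((Nat.coprime_primes (Nat.prime_of_mem_primeFactors ha)
        (Nat.prime_of_mem_primeFactors hb)).2 hab))
      fun p hp ↦ (Nat.prime_of_mem_primeFactors hp).squarefree
  calc _ = ∑ n ∈ Ioc 0 M with Q.Coprime n, term k Q n := by
        rw [sum_filter]
        refine sum_congr rfl fun n _ ↦ ?_
        split_ifs with h
        · rfl
        · simp [term_apply, h]
    _ = ∑ d ∈ Ioc 0 M with Squarefree d ∧ Q.Coprime d,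
          ∑ n ∈ Ioc 0 M with Q.Coprime n ∧ ∏ p ∈ n.primeFactors, p = d, term k Q n := by
        rw [← sum_fiberwise_of_maps_to hrad]
        simp only [filter_filter]
    _ ≤ _ := by
        refine sum_le_sum fun d hd ↦ ?_
        obtain ⟨hsq, hQd⟩ := (mem_filter.1 hd).2
        refine le_trans (sum_le_sum_of_subset_of_nonneg ?_ fun _ _ _ ↦ term_nonneg _ _ _)
          (sum_term_radical_le hk M hsq hQd)
        exact fun n hn ↦ mem_filter.2 ⟨(mem_filter.1 hn).1, (mem_filter.1 hn).2.2⟩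

end RoughSum

namespace ShiftedProduct

open Finset ArithmeticFunction
open scoped ArithmeticFunction.omega

/-- The product `(6k + 4)(6k + 5)(6k + 6)` of three consecutive integers. -/
def shiftedProduct {R : Type*} [CommSemiring R] (k : R) : R := (6 * k + 4) * (6 * k + 5) * (6 * k + 6)

/-- The number of zeros of `shiftedProduct` modulo `d`. -/
noncomputable def rootCount (d : ℕ) : ℕ := {a : ZMod d | shiftedProduct a = 0}.ncard

theorem map_shiftedProduct {R S : Type*} [CommSemiring R] [CommSemiring S] (f : R →+* S) (k : R) :
    f (shiftedProduct k) = shiftedProduct (f k) := by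
  simp only [shiftedProduct, map_mul, map_add, map_ofNat]

theorem rootCount_mul {m n : ℕ} (h : m.Coprime n) :
    rootCount (m * n) = rootCount m * rootCount n := by
  let e := ZMod.chineseRemainder h
  rw [rootCount, rootCount, rootCount, ← Set.ncard_prod, ← Set.ncard_image_of_injective _ e.injective]
  congr 1
  ext x
  rw [Set.mem_prod, Set.mem_ofPred_eq, Set.mem_ofPred_eq]
  have hfst : (shiftedProduct x).1 = shiftedProduct x.1 :=
    map_shiftedProduct (RingHom.fst (ZMod m) (ZMod n)) x
  have hsnd : (shiftedProduct x).2 = shiftedProduct x.2 :=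
    map_shiftedProduct (RingHom.snd (ZMod m) (ZMod n)) x
  rw [← hfst, ← hsnd]
  constructor
  · rintro ⟨a, ha, rfl⟩
    rw [← RingEquiv.coe_toRingHom, ← map_shiftedProduct, (show shiftedProduct a = 0 from ha), _root_.map_zero]
    exact ⟨rfl, rfl⟩
  · intro hx
    refine ⟨e.symm x, ?_, e.apply_symm_apply x⟩
    rw [Set.mem_ofPred_eq, ← RingEquiv.coe_toRingHom, ← map_shiftedProduct,
      show shiftedProduct x = 0 from Prod.ext hx.1 hx.2, _root_.map_zero]

theorem rootCount_prime {p : ℕ} (hp : p.Prime) (h5 : 5 ≤ p) : rootCount p = 3 := by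
  have : Fact p.Prime := ⟨hp⟩
  have h2 : (2 : ZMod p) ≠ 0 := by
    intro h
    have := Nat.le_of_dvd two_pos ((ZMod.natCast_eq_zero_iff 2 p).1 (by exact_mod_cast h))
    omega
  have h3 : (3 : ZMod p) ≠ 0 := by
    intro h
    have := Nat.le_of_dvd three_pos ((ZMod.natCast_eq_zero_iff 3 p).1 (by exact_mod_cast h))
    omega
  have h6 : (6 : ZMod p) ≠ 0 := by
    rw [show (6 : ZMod p) = 2 * 3 by norm_num]
    exact mul_ne_zero h2 h3
  have hset : {a : ZMod p | shiftedProduct a = 0} = {-4 / 6, -5 / 6, -6 / 6} := by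
    ext a
    simp only [shiftedProduct, Set.mem_ofPred_eq, Set.mem_insert_iff, Set.mem_singleton_iff,
      mul_eq_zero, eq_div_iff h6, or_assoc]
    refine or_congr ?_ (or_congr ?_ ?_) <;>
      exact ⟨fun h ↦ by linear_combination h, fun h ↦ by linear_combination h⟩
  rw [rootCount, hset, Set.ncard_eq_three]
  refine ⟨_, _, _, ?_, ?_, ?_, rfl⟩
  · rw [Ne, div_left_inj' h6]
    exact fun h ↦ one_ne_zero (α := ZMod p) (by linear_combination h)
  · rw [Ne, div_left_inj' h6]
    exact fun h ↦ h2 (by linear_combination h)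
  · rw [Ne, div_left_inj' h6]
    exact fun h ↦ one_ne_zero (α := ZMod p) (by linear_combination h)

theorem rootCount_squarefree {d : ℕ} (hd : Squarefree d) (h5 : ∀ p, p.Prime → p ∣ d → 5 ≤ p) :
    rootCount d = 3 ^ ω d := by
  induction d using induction_on_primes with
  | zero => exact absurd hd not_squarefree_zero
  | one =>
    have : {a : ZMod 1 | shiftedProduct a = 0} = {0} := by
      ext a
      simp [Subsingleton.elim a 0, Subsingleton.elim (shiftedProduct (0 : ZMod 1)) 0]
    rw [rootCount, this]
    simp
  | prime_mul p m hp ih =>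
    have hcop := Nat.coprime_of_squarefree_mul hd
    rw [rootCount_mul hcop, rootCount_prime hp (h5 p hp (dvd_mul_right _ _)),
      ih (hd.squarefree_of_dvd (dvd_mul_left _ _)) fun q hq hqm ↦ h5 q hq (hqm.mul_left p),
      cardDistinctFactors_mul hcop, cardDistinctFactors_apply_prime hp, pow_add, pow_one]

theorem abs_card_range_filter_natCast_sub_le {d : ℕ} [NeZero d] (K : ℕ) (a : ZMod d) :
    |(#{k ∈ range K | ((k : ℕ) : ZMod d) = a} : ℝ) - K / d| ≤ 1 := by
  have hd : 0 < d := Nat.pos_of_ne_zero (NeZero.ne d)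
  have hd' : (0 : ℝ) < d := by exact_mod_cast hd
  have hcount : #{k ∈ range K | ((k : ℕ) : ZMod d) = a} =
      K / d + if a.val % d < K % d then 1 else 0 := by
    rw [← Nat.count_modEq_card K hd, Nat.count_eq_card_filter_range]
    congr 1
    refine filter_congr fun k _ ↦ ?_
    rw [← ZMod.natCast_eq_natCast_iff, ZMod.natCast_zmod_val]
  have hK : (K : ℝ) / d = (K / d : ℕ) + (K % d : ℕ) / d := by
    rw [div_eq_iff hd'.ne', add_mul, div_mul_cancel₀ _ hd'.ne']
    exact_mod_cast (Nat.div_add_mod' K d).symm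
  have hlt : ((K % d : ℕ) : ℝ) / d ≤ 1 := by
    rw [div_le_one hd']
    exact_mod_cast (Nat.mod_lt K hd).le
  have hge : 0 ≤ ((K % d : ℕ) : ℝ) / d := by positivity
  rw [hcount, hK, abs_le]
  push_cast at hlt hge ⊢
  split_ifs <;> constructor <;> linarith

theorem abs_card_dvd_shiftedProduct_sub_le {d : ℕ} (hd : d ≠ 0) (K : ℕ) :
    |(#{k ∈ range K | d ∣ shiftedProduct k} : ℝ) - rootCount d * K / d| ≤ rootCount d := by
  classical
  have : NeZero d := ⟨hd⟩
  set R : Finset (ZMod d) := {a | shiftedProduct a = 0} with hR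
  have hcard : rootCount d = #R := by
    rw [rootCount, ← Set.ncard_coe_finset]
    congr 1
    ext a
    simp [hR]
  have hfib : #{k ∈ range K | d ∣ shiftedProduct k} =
      ∑ a ∈ R, #{k ∈ range K | ((k : ℕ) : ZMod d) = a} := by
    have hiff : ∀ k : ℕ, d ∣ shiftedProduct k ↔ ((k : ℕ) : ZMod d) ∈ R := by
      intro k
      rw [hR, mem_filter_univ, ← ZMod.natCast_eq_zero_iff]
      rw [show ((shiftedProduct k : ℕ) : ZMod d) = shiftedProduct ((k : ℕ) : ZMod d) from
        map_shiftedProduct (Nat.castRingHom (ZMod d)) k]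
    rw [card_eq_sum_card_fiberwise (f := fun k : ℕ ↦ (k : ZMod d)) (t := R)
      fun k hk ↦ (hiff k).1 (mem_filter.1 hk).2]
    refine sum_congr rfl fun a ha ↦ ?_
    rw [filter_filter]
    congr 1
    refine filter_congr fun k _ ↦ ⟨fun h ↦ h.2, fun h ↦ ⟨(hiff k).2 (h ▸ ha), h⟩⟩
  have hmain : (#R : ℝ) * K / d = ∑ _a ∈ R, (K / d : ℝ) := by
    rw [sum_const, nsmul_eq_mul, mul_div_assoc]
  rw [hfib, hcard, hmain]
  push_cast
  rw [← sum_sub_distrib]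
  refine (abs_sum_le_sum_abs _ _).trans ?_
  refine (sum_le_sum fun a _ ↦ abs_card_range_filter_natCast_sub_le K a).trans ?_
  simp

theorem shiftedProduct_strictMono : StrictMono (shiftedProduct : ℕ → ℕ) := by
  intro a b hab
  simp only [shiftedProduct]
  gcongr

/-- The density `d ↦ 3 ^ ω(d) / d`. -/
noncomputable def density : ArithmeticFunction ℝ := ⟨fun d ↦ 3 ^ ω d / d, by simp⟩

theorem density_apply (d : ℕ) : density d = 3 ^ ω d / d := rfl

theorem density_prime {p : ℕ} (hp : p.Prime) : density p = 3 / p := by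
  rw [density_apply, cardDistinctFactors_apply_prime hp, pow_one]

theorem density_isMultiplicative : density.IsMultiplicative := by
  refine ⟨by simp [density_apply], fun {m n} h ↦ ?_⟩
  rw [density_apply, density_apply, density_apply, cardDistinctFactors_mul h, pow_add,
    div_mul_div_comm, Nat.cast_mul]

/-- The product of the primes in `[5, N]`. -/
def sievePrimorial (N : ℕ) : ℕ := ∏ p ∈ Icc 5 N with p.Prime, p

theorem prime_dvd_sievePrimorial {p N : ℕ} (hp : p.Prime) :
    p ∣ sievePrimorial N ↔ 5 ≤ p ∧ p ≤ N := by
  rw [sievePrimorial, hp.prime.dvd_finsetProd_iff]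
  constructor
  · rintro ⟨q, hq, hpq⟩
    rw [mem_filter, mem_Icc] at hq
    rw [(Nat.prime_dvd_prime_iff_eq hp hq.2).1 hpq]
    exact hq.1
  · exact fun h ↦ ⟨p, mem_filter.2 ⟨mem_Icc.2 h, hp⟩, dvd_rfl⟩

theorem squarefree_sievePrimorial (N : ℕ) : Squarefree (sievePrimorial N) :=
  squarefree_prod_of_pairwise_isCoprime (fun _ ha _ hb hab ↦
    Nat.coprime_iff_isRelPrime.1 ((Nat.coprime_primes (mem_filter.1 ha).2
      (mem_filter.1 hb).2).2 hab)) fun _ hp ↦ (mem_filter.1 hp).2.squarefree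

theorem primeFactors_sievePrimorial (N : ℕ) :
    (sievePrimorial N).primeFactors = {p ∈ Icc 5 N | p.Prime} :=
  Nat.primeFactors_prod fun _ hp ↦ (mem_filter.1 hp).2

/-- The sieve problem for the values `shiftedProduct k`, `k < K`, and the primes in `[5, N]`. -/
noncomputable def sieve (K N : ℕ) : BoundingSieve where
  support := (range K).image shiftedProduct
  prodPrimes := sievePrimorial N
  prodPrimes_squarefree := squarefree_sievePrimorial N
  weights _ := 1
  weights_nonneg _ := zero_le_one
  totalMass := K
  nu := density
  nu_mult := density_isMultiplicative
  nu_pos_of_prime p hp _ := by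
    have : (0 : ℝ) < p := by exact_mod_cast hp.pos
    rw [density_prime hp]
    positivity
  nu_lt_one_of_prime p hp hdvd := by
    have : (5 : ℝ) ≤ p := by exact_mod_cast ((prime_dvd_sievePrimorial hp).1 hdvd).1
    rw [density_prime hp, div_lt_one (by linarith)]
    linarith

theorem siftedSum_sieve (K N : ℕ) : (sieve K N).siftedSum =
    #{k ∈ range K | (sievePrimorial N).Coprime (shiftedProduct k)} := by
  have h : (sieve K N).siftedSum = ∑ n ∈ (range K).image shiftedProduct,
      if (sievePrimorial N).Coprime n then (1 : ℝ) else 0 := by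
    rw [BoundingSieve.siftedSum]
    rfl
  rw [h, sum_image fun _ _ _ _ h ↦ shiftedProduct_strictMono.injective h, sum_boole]

theorem abs_rem_sieve_le {K N d : ℕ} (hd : d ∣ sievePrimorial N) :
    |(sieve K N).rem d| ≤ 3 ^ ω d := by
  have hsq := (squarefree_sievePrimorial N).squarefree_of_dvd hd
  have h := abs_card_dvd_shiftedProduct_sub_le hsq.ne_zero K
  rw [rootCount_squarefree hsq fun p hp hpd ↦
    ((prime_dvd_sievePrimorial hp).1 (hpd.trans hd)).1] at h
  push_cast at h
  refine le_trans (le_of_eq ?_) h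
  simp only [BoundingSieve.rem, BoundingSieve.multSum, sieve]
  rw [sum_image fun _ _ _ _ h ↦ shiftedProduct_strictMono.injective h, density_apply]
  simp only [sum_boole]
  congr 2
  ring

theorem cardDistinctFactors_eq_card_primeFactors (n : ℕ) : ω n = #n.primeFactors := by
  rw [cardDistinctFactors_apply, ← List.card_toFinset, ← Nat.primeFactors]

theorem cardDistinctFactors_lcm_le {m n : ℕ} (hm : m ≠ 0) (hn : n ≠ 0) :
    ω (m.lcm n) ≤ ω m + ω n := by
  simp only [cardDistinctFactors_eq_card_primeFactors]
  refine (card_le_card ?_).trans (card_union_le _ _)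
  rw [← Nat.primeFactors_mul hm hn]
  exact Nat.primeFactors_mono (Nat.lcm_dvd_mul m n) (mul_ne_zero hm hn)

theorem abs_selbergWeight_sieve_le {K N d : ℕ} (hN : 1 ≤ N) (hd : d ∣ sievePrimorial N) :
    |(sieve K N).selbergWeight N d| ≤ 3 ^ ω d := by
  refine (BoundingSieve.abs_selbergWeight_le hN hd).trans ?_
  rw [cardDistinctFactors_eq_card_primeFactors, ← prod_const]
  refine prod_le_prod (fun p hp ↦ ?_) fun p hp ↦ ?_ <;>
  · have hpp := Nat.prime_of_mem_primeFactors hp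
    have h5 : (5 : ℝ) ≤ p := by
      exact_mod_cast ((prime_dvd_sievePrimorial hpp).1 ((Nat.dvd_of_mem_primeFactors hp).trans hd)).1
    have hnu : (sieve K N).nu p = 3 / p := density_prime hpp
    have hle : (3 : ℝ) / p ≤ 3 / 5 := by gcongr
    rw [hnu]
    first
    | exact inv_nonneg.2 (by linarith)
    | exact inv_le_of_inv_le₀ (by norm_num) (by linarith)

end ShiftedProduct

namespace ShiftedProduct

open Finset ArithmeticFunction

/-- The multiplicative function `d ↦ ∏_{p ∣ d} 3 / (p - 3)`. -/
noncomputable def sieveTerm : ArithmeticFunction ℝ :=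
  prodPrimeFactors fun p ↦ (3 / (p - 3) : ℝ)

theorem sieveTerm_apply {d : ℕ} (hd : d ≠ 0) :
    sieveTerm d = ∏ p ∈ d.primeFactors, (3 / (p - 3) : ℝ) :=
  prodPrimeFactors_apply hd

theorem sieveTerm_isMultiplicative : sieveTerm.IsMultiplicative :=
  IsMultiplicative.prodPrimeFactors _

theorem sieveTerm_prime {p : ℕ} (hp : p.Prime) : sieveTerm p = 3 / (p - 3) := by
  rw [sieveTerm_apply hp.ne_zero, hp.primeFactors, prod_singleton]

theorem sieveTerm_nonneg {d : ℕ} (hd : d ≠ 0) (h5 : ∀ p, p.Prime → p ∣ d → 5 ≤ p) :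
    0 ≤ sieveTerm d := by
  rw [sieveTerm_apply hd]
  refine prod_nonneg fun p hp ↦ ?_
  have : (5 : ℝ) ≤ p := by
    exact_mod_cast h5 p (Nat.prime_of_mem_primeFactors hp) (Nat.dvd_of_mem_primeFactors hp)
  exact div_nonneg (by norm_num) (by linarith)

theorem selbergTerms_sieve {K N d : ℕ} (hd : d ∣ sievePrimorial N) :
    (sieve K N).selbergTerms d = sieveTerm d := by
  have hsq := (squarefree_sievePrimorial N).squarefree_of_dvd hd
  have hnu : (sieve K N).nu d = ∏ p ∈ d.primeFactors, (3 / p : ℝ) := by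
    change density d = _
    rw [prod_div_distrib, prod_const, density_apply, cardDistinctFactors_eq_card_primeFactors]
    congr 1
    rw [← Nat.cast_prod, Nat.prod_primeFactors_of_squarefree hsq]
  rw [BoundingSieve.selbergTerms_apply, hnu, ← prod_mul_distrib, sieveTerm_apply hsq.ne_zero]
  refine prod_congr rfl fun p hp ↦ ?_
  have hpp := Nat.prime_of_mem_primeFactors hp
  have h5 : (5 : ℝ) ≤ p := by
    exact_mod_cast ((prime_dvd_sievePrimorial hpp).1 ((Nat.dvd_of_mem_primeFactors hp).trans hd)).1
  rw [show (sieve K N).nu p = 3 / p from density_prime hpp]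
  have h0 : (p : ℝ) ≠ 0 := by linarith
  have h3 : (p : ℝ) - 3 ≠ 0 := by linarith
  field_simp

theorem dvd_sievePrimorial {d N : ℕ} (hd : Squarefree d)
    (h : ∀ p, p.Prime → p ∣ d → 5 ≤ p ∧ p ≤ N) : d ∣ sievePrimorial N := by
  rw [← Nat.prod_primeFactors_of_squarefree hd]
  refine prod_dvd_prod_of_subset _ _ _ fun p hp ↦ ?_
  have hpp := Nat.prime_of_mem_primeFactors hp
  exact mem_filter.2 ⟨mem_Icc.2 (h p hpp (Nat.dvd_of_mem_primeFactors hp)), hpp⟩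

theorem five_le_of_coprime_six {p : ℕ} (hp : p.Prime) (h : Nat.Coprime 6 p) : 5 ≤ p := by
  by_contra! hlt
  have := hp.two_le
  interval_cases p
  · norm_num at h
  · norm_num at h
  · norm_num at hp

theorem sum_sieveTerm_mul_sum_le_selbergSum (K : ℕ) {y N : ℕ} (hyN : y ≤ N) :
    (∑ d ∈ (sievePrimorial y).divisors, sieveTerm d) *
      ∑ d ∈ Ioc 0 (N / sievePrimorial y) with Squarefree d ∧ (6 * sievePrimorial y).Coprime d,
        sieveTerm d ≤ (sieve K N).selbergSum N := by
  set P := sievePrimorial y with hP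
  set D := {d ∈ Ioc 0 (N / P) | Squarefree d ∧ (6 * P).Coprime d} with hD
  have hcop : ∀ a ∈ P.divisors ×ˢ D, a.1.Coprime a.2 := by
    intro a ha
    obtain ⟨h1, h2⟩ := mem_product.1 ha
    exact (mem_filter.1 h2).2.2.coprime_mul_left.coprime_dvd_left (Nat.dvd_of_mem_divisors h1)
  have hgcd : ∀ a ∈ P.divisors ×ˢ D, (a.1 * a.2).gcd P = a.1 := by
    intro a ha
    obtain ⟨h1, h2⟩ := mem_product.1 ha
    rw [Nat.Coprime.gcd_mul_right_cancel _ (mem_filter.1 h2).2.2.coprime_mul_left.symm]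
    exact Nat.gcd_eq_left (Nat.dvd_of_mem_divisors h1)
  have hinj : Set.InjOn (fun a : ℕ × ℕ ↦ a.1 * a.2) (P.divisors ×ˢ D : Finset (ℕ × ℕ)) := by
    intro a ha b hb hab
    have h1 : a.1 = b.1 := by
      rw [← hgcd a ha, ← hgcd b hb]
      exact congrArg (Nat.gcd · P) hab
    refine Prod.ext h1 ?_
    have hpos := Nat.pos_of_mem_divisors (mem_product.1 ha).1
    refine Nat.eq_of_mul_eq_mul_left hpos ?_
    simpa [h1] using hab
  rw [sum_mul_sum, ← sum_product']
  calc _ = ∑ a ∈ P.divisors ×ˢ D, sieveTerm (a.1 * a.2) :=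
        sum_congr rfl fun a ha ↦ (sieveTerm_isMultiplicative.map_mul_of_coprime (hcop a ha)).symm
    _ = ∑ d ∈ (P.divisors ×ˢ D).image fun a ↦ a.1 * a.2, sieveTerm d := (sum_image hinj).symm
    _ ≤ ∑ d ∈ (sieve K N).boundedDivisors N, sieveTerm d := by
        refine sum_le_sum_of_subset_of_nonneg ?_ fun d hd _ ↦ ?_
        · intro d hd
          obtain ⟨a, ha, rfl⟩ := mem_image.1 hd
          obtain ⟨h1, h2⟩ := mem_product.1 ha
          obtain ⟨h2, hsq2, hcop2⟩ := mem_filter.1 h2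
          obtain ⟨hpos, hle⟩ := mem_Ioc.1 h2
          have hdvd := Nat.dvd_of_mem_divisors h1
          have hPpos : 0 < P := Nat.pos_of_ne_zero (squarefree_sievePrimorial y).ne_zero
          refine BoundingSieve.mem_boundedDivisors.2 ⟨dvd_sievePrimorial ?_ ?_, ?_⟩
          · exact (Nat.squarefree_mul (hcop a ha)).2
              ⟨(squarefree_sievePrimorial y).squarefree_of_dvd hdvd, hsq2⟩
          · intro p hp hpd
            rcases hp.dvd_mul.1 hpd with h | h
            · have := (prime_dvd_sievePrimorial hp).1 (h.trans hdvd)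
              exact ⟨this.1, this.2.trans hyN⟩
            · refine ⟨five_le_of_coprime_six hp
                (hcop2.coprime_mul_right.coprime_dvd_right h), ?_⟩
              exact (Nat.le_of_dvd hpos h).trans (hle.trans (Nat.div_le_self _ _))
          · calc a.1 * a.2 ≤ P * (N / P) := Nat.mul_le_mul (Nat.le_of_dvd hPpos hdvd) hle
              _ ≤ N := Nat.mul_div_le _ _
        · have hdvd := (BoundingSieve.mem_boundedDivisors.1 hd).1
          refine sieveTerm_nonneg (ne_zero_of_dvd_ne_zero
            (squarefree_sievePrimorial N).ne_zero hdvd) fun p hp hpd ↦ ?_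
          exact ((prime_dvd_sievePrimorial hp).1 (hpd.trans hdvd)).1
    _ = _ := sum_congr rfl fun d hd ↦
        (selbergTerms_sieve (BoundingSieve.mem_boundedDivisors.1 hd).1).symm

/-- The factor of the singular series at `p`. -/
noncomputable def localFactor (p : ℕ) : ℝ := (1 - 3 / (p : ℝ)) * ((1 - 1 / (p : ℝ))⁻¹) ^ 3

/-- The partial product of the singular series over the primes in `[5, y]`. -/
noncomputable def partialProduct (y : ℕ) : ℝ := ∏ p ∈ Icc 5 y with p.Prime, localFactor p

theorem localFactor_pos {p : ℕ} (hp : 5 ≤ p) : 0 < localFactor p := by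
  have h5 : (5 : ℝ) ≤ p := by exact_mod_cast hp
  have h3 : (3 : ℝ) / p < 1 := by rw [div_lt_one (by linarith)]; linarith
  have h1 : (1 : ℝ) / p < 1 := by rw [div_lt_one (by linarith)]; linarith
  exact mul_pos (by linarith) (pow_pos (inv_pos.2 (by linarith)) 3)

theorem localFactor_le_one {p : ℕ} (hp : 5 ≤ p) : localFactor p ≤ 1 := by
  have h5 : (5 : ℝ) ≤ p := by exact_mod_cast hp
  have h1 : (1 : ℝ) / p < 1 := by rw [div_lt_one (by linarith)]; linarith
  have h0 : (0 : ℝ) < 1 / p := by positivity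
  rw [localFactor, inv_pow, ← div_eq_mul_inv, div_le_one (pow_pos (by linarith) 3),
    show (3 : ℝ) / p = 3 * (1 / p) by ring]
  nlinarith [mul_nonneg (sq_nonneg (1 / (p : ℝ))) (show (0 : ℝ) ≤ 3 - 1 / p by linarith)]

theorem partialProduct_pos (y : ℕ) : 0 < partialProduct y :=
  prod_pos fun _ hp ↦ localFactor_pos (mem_Icc.1 (mem_filter.1 hp).1).1

theorem partialProduct_le_one (y : ℕ) : partialProduct y ≤ 1 :=
  prod_le_one (fun _ hp ↦ (localFactor_pos (mem_Icc.1 (mem_filter.1 hp).1).1).le)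
    fun _ hp ↦ localFactor_le_one (mem_Icc.1 (mem_filter.1 hp).1).1

theorem totient_div_six_mul_sievePrimorial (y : ℕ) :
    ((6 * sievePrimorial y).totient : ℝ) / ↑(6 * sievePrimorial y) =
      1 / 3 * ∏ p ∈ Icc 5 y with p.Prime, (1 - 1 / (p : ℝ)) := by
  have hcop : Nat.Coprime 6 (sievePrimorial y) := by
    refine Nat.coprime_of_dvd fun p hp h6 hP ↦ ?_
    have h5 := ((prime_dvd_sievePrimorial hp).1 hP).1
    have h6' := Nat.le_of_dvd (by norm_num) h6
    interval_cases p
    · norm_num at h6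
    · norm_num at hp
  have h6 : Nat.totient 6 = 2 := by decide
  have hP : ((sievePrimorial y).totient : ℝ) =
      sievePrimorial y * ∏ p ∈ Icc 5 y with p.Prime, (1 - 1 / (p : ℝ)) := by
    have h := Nat.totient_eq_mul_prod_factors (sievePrimorial y)
    rw [primeFactors_sievePrimorial] at h
    have h' := congrArg (Rat.cast : ℚ → ℝ) h
    push_cast at h'
    simpa only [one_div] using h'
  have h0 : (sievePrimorial y : ℝ) ≠ 0 := by
    exact_mod_cast (squarefree_sievePrimorial y).ne_zero
  rw [Nat.totient_mul hcop, h6]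
  push_cast
  rw [hP]
  field_simp
  ring

theorem sum_divisors_sievePrimorial_sieveTerm (y : ℕ) :
    ∑ d ∈ (sievePrimorial y).divisors, sieveTerm d =
      ∏ p ∈ Icc 5 y with p.Prime, (1 - 3 / (p : ℝ))⁻¹ := by
  rw [← sieveTerm_isMultiplicative.prodPrimeFactors_one_add_of_squarefree
    (squarefree_sievePrimorial y), primeFactors_sievePrimorial]
  refine prod_congr rfl fun p hp ↦ ?_
  obtain ⟨hp5, hp⟩ := mem_filter.1 hp
  have h5 : (5 : ℝ) ≤ p := by exact_mod_cast (mem_Icc.1 hp5).1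
  have h0 : (p : ℝ) ≠ 0 := by linarith
  have h3 : (p : ℝ) - 3 ≠ 0 := by linarith
  rw [sieveTerm_prime hp]
  field_simp
  ring

theorem le_selbergSum_sieve (K : ℕ) {y N : ℕ} (hyN : y ≤ N) (hPN : sievePrimorial y ≤ N) :
    (162 * partialProduct y)⁻¹ *
        Real.posLog ((N / sievePrimorial y : ℝ) / (6 * sievePrimorial y) ^ 3) ^ 3 ≤
      (sieve K N).selbergSum N := by
  set P := sievePrimorial y with hP
  have hP0 : P ≠ 0 := (squarefree_sievePrimorial y).ne_zero
  have hPpos : (0 : ℝ) < P := by positivity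
  have hQ0 : 6 * P ≠ 0 := by positivity
  have hV : 0 ≤ ∏ p ∈ Icc 5 y with p.Prime, (1 - 3 / (p : ℝ))⁻¹ := by
    refine prod_nonneg fun p hp ↦ inv_nonneg.2 ?_
    have h5 : (5 : ℝ) ≤ p := by exact_mod_cast (mem_Icc.1 (mem_filter.1 hp).1).1
    rw [sub_nonneg, div_le_one (by linarith)]
    linarith
  have h1 := RoughSum.sum_term_ge hQ0 3 (y := N / P)
    ((one_le_div hPpos).2 (by exact_mod_cast hPN))
  have h2 := RoughSum.sum_term_le_sum_squarefree (k := 3) (Q := 6 * P)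
    (fun p hp hcop ↦ by
      have := five_le_of_coprime_six hp hcop.coprime_mul_right
      omega) (N / P)
  rw [Nat.floor_div_natCast, Nat.floor_natCast] at h1
  have h3 : ∑ d ∈ Ioc 0 (N / P) with Squarefree d ∧ (6 * P).Coprime d,
      ∏ p ∈ d.primeFactors, ((3 : ℕ) / (p - (3 : ℕ)) : ℝ) =
      ∑ d ∈ Ioc 0 (N / P) with Squarefree d ∧ (6 * P).Coprime d, sieveTerm d := by
    refine sum_congr rfl fun d hd ↦ ?_
    rw [sieveTerm_apply (mem_filter.1 hd).2.1.ne_zero]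
    norm_num
  have h4 := sum_sieveTerm_mul_sum_le_selbergSum K hyN
  rw [sum_divisors_sievePrimorial_sieveTerm, ← hP, ← h3] at h4
  refine le_trans (le_of_eq ?_) ((mul_le_mul_of_nonneg_left (h1.trans h2) hV).trans h4)
  rw [totient_div_six_mul_sievePrimorial, partialProduct, show Nat.factorial 3 = 6 from rfl]
  simp only [localFactor, prod_mul_distrib, prod_inv_distrib, prod_pow, mul_inv, inv_pow, inv_inv]
  push_cast
  ring

end ShiftedProduct

namespace ShiftedProduct

open Finset ArithmeticFunction Filter
open scoped ArithmeticFunction.omega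

theorem exists_pow_cardDistinctFactors_le (b : ℝ) (hb : 1 ≤ b) {δ : ℝ} (hδ : 0 < δ) :
    ∃ C : ℝ, ∀ d : ℕ, Squarefree d → b ^ ω d ≤ C * (d : ℝ) ^ δ := by
  obtain ⟨B, hB⟩ := eventually_atTop.1
    (((tendsto_rpow_atTop hδ).comp tendsto_natCast_atTop_atTop).eventually_ge_atTop b)
  refine ⟨b ^ B, fun d hd ↦ ?_⟩
  have hpow : ∏ p ∈ d.primeFactors, (p : ℝ) ^ δ = (d : ℝ) ^ δ := by
    rw [Real.finsetProd_rpow _ _ fun p _ ↦ Nat.cast_nonneg p, ← Nat.cast_prod,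
      Nat.prod_primeFactors_of_squarefree hd]
  calc b ^ ω d = ∏ _p ∈ d.primeFactors, b := by
        rw [prod_const, cardDistinctFactors_eq_card_primeFactors]
    _ ≤ ∏ p ∈ d.primeFactors, (if p ∈ range B then b else 1) * (p : ℝ) ^ δ := by
        refine prod_le_prod (fun _ _ ↦ by linarith) fun p hp ↦ ?_
        have hp1 : (1 : ℝ) ≤ p := by exact_mod_cast (Nat.prime_of_mem_primeFactors hp).one_le
        split_ifs with h
        · exact le_mul_of_one_le_right (by linarith) (Real.one_le_rpow hp1 hδ.le)
        · rw [one_mul]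
          exact hB p (not_lt.1 fun hlt ↦ h (mem_range.2 hlt))
    _ = b ^ #{p ∈ d.primeFactors | p ∈ range B} * (d : ℝ) ^ δ := by
        rw [prod_mul_distrib, hpow, prod_ite, prod_const, prod_const_one, mul_one]
    _ ≤ b ^ B * (d : ℝ) ^ δ := by
        gcongr
        refine (card_le_card (t := range B) fun p hp ↦ (mem_filter.1 hp).2).trans ?_
        rw [card_range]

theorem siftedSum_sieve_le (K : ℕ) {N : ℕ} (hN : 1 ≤ N) :
    (sieve K N).siftedSum ≤ K / (sieve K N).selbergSum N +
      (∑ d ∈ (sieve K N).boundedDivisors N, (9 : ℝ) ^ ω d) ^ 2 := by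
  refine (BoundingSieve.siftedSum_le_selberg hN).trans ?_
  rw [sq, sum_mul_sum]
  refine add_le_add le_rfl (sum_le_sum fun d₁ h₁ ↦ sum_le_sum fun d₂ h₂ ↦ ?_)
  have hd₁ : d₁ ∣ sievePrimorial N := (BoundingSieve.mem_boundedDivisors.1 h₁).1
  have hd₂ : d₂ ∣ sievePrimorial N := (BoundingSieve.mem_boundedDivisors.1 h₂).1
  have h0 := (squarefree_sievePrimorial N).ne_zero
  have hrem : |(sieve K N).rem (d₁.lcm d₂)| ≤ 3 ^ ω d₁ * 3 ^ ω d₂ := by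
    refine (abs_rem_sieve_le (Nat.lcm_dvd hd₁ hd₂)).trans ?_
    rw [← pow_add]
    exact pow_le_pow_right₀ (by norm_num) (cardDistinctFactors_lcm_le
      (ne_zero_of_dvd_ne_zero h0 hd₁) (ne_zero_of_dvd_ne_zero h0 hd₂))
  refine (mul_le_mul (mul_le_mul (abs_selbergWeight_sieve_le hN hd₁)
    (abs_selbergWeight_sieve_le hN hd₂) (abs_nonneg _) (by positivity)) hrem (abs_nonneg _)
    (by positivity)).trans (le_of_eq ?_)
  rw [show (9 : ℝ) = 3 * 3 by norm_num, mul_pow, mul_pow]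
  ring

theorem exists_sum_boundedDivisors_le {δ : ℝ} (hδ : 0 < δ) :
    ∃ C : ℝ, 0 ≤ C ∧ ∀ K N : ℕ,
      ∑ d ∈ (sieve K N).boundedDivisors N, (9 : ℝ) ^ ω d ≤ C * (N : ℝ) ^ (1 + δ) := by
  obtain ⟨C, hC⟩ := exists_pow_cardDistinctFactors_le 9 (by norm_num) hδ
  have hC0 : 0 ≤ C := by
    have := hC 1 squarefree_one
    norm_num at this
    linarith
  refine ⟨C, hC0, fun K N ↦ ?_⟩
  have hsub : (sieve K N).boundedDivisors N ⊆ Ioc 0 N := fun d hd ↦ by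
    have hd := BoundingSieve.mem_boundedDivisors.1 hd
    exact mem_Ioc.2 ⟨Nat.pos_of_ne_zero
      (ne_zero_of_dvd_ne_zero (sieve K N).prodPrimes_ne_zero hd.1), hd.2⟩
  calc _ ≤ ∑ d ∈ (sieve K N).boundedDivisors N, C * (N : ℝ) ^ δ := by
        refine sum_le_sum fun d hd ↦ ?_
        have hd := BoundingSieve.mem_boundedDivisors.1 hd
        refine (hC d ((squarefree_sievePrimorial N).squarefree_of_dvd hd.1)).trans ?_
        gcongr
        exact hd.2
    _ ≤ N * (C * (N : ℝ) ^ δ) := by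
        rw [sum_const, nsmul_eq_mul]
        gcongr
        exact (card_le_card hsub).trans (by simp)
    _ = C * (N : ℝ) ^ (1 + δ) := by
        rw [Real.rpow_add_of_nonneg (Nat.cast_nonneg N) zero_le_one hδ.le, Real.rpow_one]
        ring

end ShiftedProduct

theorem mod_six_eq_five_of_mem_A {p : ℕ} (hp : p ∈ A) : p % 6 = 5 := by
  obtain ⟨-, hp3, α, _, _, _, _, hα, -, -, -, -, -, -, h, -⟩ := hp
  have h2 : 2 ∣ p + 1 := by
    rw [h, mul_assoc]
    exact (dvd_pow_self 2 (by omega)).mul_right _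
  omega

theorem coprime_sievePrimorial_of_mem_A {N p α β γ q r : ℕ} (hp : p.Prime) (hq : q.Prime)
    (hr : r.Prime) (hadd : p + 1 = 2 ^ α * 3 ^ β * q) (hsub : p - 1 = 2 ^ γ * r)
    (hpN : N < p) (hqN : N < q) (hrN : N < r) :
    (ShiftedProduct.sievePrimorial N).Coprime ((p - 1) * p * (p + 1)) := by
  refine Nat.coprime_of_dvd fun l hl hlP hdvd ↦ ?_
  obtain ⟨h5, hlN⟩ := (ShiftedProduct.prime_dvd_sievePrimorial hl).1 hlP
  have key : ∀ n : ℕ, n.Prime → l ∣ n → l = n := fun n hn h ↦ (Nat.prime_dvd_prime_iff_eq hl hn).1 h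
  rw [hadd, hsub] at hdvd
  simp only [hl.dvd_mul] at hdvd
  rcases hdvd with ((h | h) | h) | ((h | h) | h)
  · have := key 2 Nat.prime_two (hl.dvd_of_dvd_pow h)
    omega
  · have := key r hr h
    omega
  · have := key p hp h
    omega
  · have := key 2 Nat.prime_two (hl.dvd_of_dvd_pow h)
    omega
  · have := key 3 Nat.prime_three (hl.dvd_of_dvd_pow h)
    omega
  · have := key q hq h
    omega

open Finset in
theorem ncard_A_le_siftedSum (X N : ℕ) :
    ((A ∩ {n : ℕ | n ≤ X}).ncard : ℝ) ≤ (ShiftedProduct.sieve (X / 6 + 1) N).siftedSum +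
      3 * ((N + 1) * (Nat.log 2 (X + 1) + 1) ^ 2) := by
  set L := Nat.log 2 (X + 1) + 1 with hL
  set S := {k ∈ range (X / 6 + 1) |
    (ShiftedProduct.sievePrimorial N).Coprime (ShiftedProduct.shiftedProduct k)} with hS
  set T := S.image (6 * · + 5) ∪ (range (N + 1) ∪
    ((range (N + 1) ×ˢ (range L ×ˢ range L)).image (fun a ↦ 2 ^ a.2.1 * 3 ^ a.2.2 * a.1 - 1) ∪
    (range (N + 1) ×ˢ range L).image fun a ↦ 2 ^ a.2 * a.1 + 1)) with hT
  have hsub : A ∩ {n : ℕ | n ≤ X} ⊆ T := by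
    rintro p ⟨hpA, hpX : p ≤ X⟩
    have h6 := mod_six_eq_five_of_mem_A hpA
    obtain ⟨hp, -, α, β, γ, q, r, -, -, -, hq, hr, -, -, hadd, hsubp⟩ := hpA
    have hp2 := hp.two_le
    have hexp : ∀ {b e : ℕ}, 2 ≤ b → b ^ e ≤ X + 1 → e < L := fun {b e} hb h ↦
      Nat.lt_succ_of_le (Nat.le_log_of_pow_le one_lt_two ((Nat.pow_le_pow_left hb e).trans h))
    rw [hT, mem_coe, mem_union, mem_union, mem_union]
    by_cases hpN : p ≤ N
    · exact .inr (.inl (mem_range.2 (by omega)))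
    by_cases hqN : q ≤ N
    · refine .inr (.inr (.inl (mem_image.2 ⟨(q, α, β), ?_, by dsimp only; omega⟩)))
      simp only [mem_product, mem_range]
      have hle : 2 ^ α * 3 ^ β * q ≤ X + 1 := by omega
      refine ⟨by omega, hexp le_rfl (le_trans ?_ hle),
        hexp (b := 3) (by norm_num) (le_trans ?_ hle)⟩
      · rw [mul_assoc]
        exact Nat.le_mul_of_pos_right _ (Nat.mul_pos (by positivity) hq.pos)
      · rw [mul_comm (2 ^ α), mul_assoc]
        exact Nat.le_mul_of_pos_right _ (Nat.mul_pos (by positivity) hq.pos)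
    by_cases hrN : r ≤ N
    · refine .inr (.inr (.inr (mem_image.2 ⟨(r, γ), ?_, by dsimp only; omega⟩)))
      simp only [mem_product, mem_range]
      have hle : 2 ^ γ * r ≤ X + 1 := by omega
      exact ⟨by omega, hexp le_rfl ((Nat.le_mul_of_pos_right _ hr.pos).trans hle)⟩
    · refine .inl (mem_image.2 ⟨p / 6, mem_filter.2 ⟨mem_range.2 ?_, ?_⟩, by omega⟩)
      · omega
      · have h : ShiftedProduct.shiftedProduct (p / 6) = (p - 1) * p * (p + 1) := by
          rw [ShiftedProduct.shiftedProduct, show 6 * (p / 6) + 4 = p - 1 by omega,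
            show 6 * (p / 6) + 5 = p by omega, show 6 * (p / 6) + 6 = p + 1 by omega]
        rw [h]
        exact coprime_sievePrimorial_of_mem_A hp hq hr hadd hsubp (by omega) (by omega) (by omega)
  have hcard : (A ∩ {n : ℕ | n ≤ X}).ncard ≤ #S + ((N + 1) + ((N + 1) * (L * L) + (N + 1) * L)) := by
    refine (Set.ncard_le_ncard hsub T.finite_toSet).trans ?_
    rw [Set.ncard_coe_finset]
    refine (card_union_le _ _).trans (add_le_add card_image_le ((card_union_le _ _).trans
      (add_le_add (card_range _).le ((card_union_le _ _).trans (add_le_add ?_ ?_)))))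
    · exact card_image_le.trans (by simp)
    · exact card_image_le.trans (by simp)
  have hL1 : 1 ≤ L := Nat.le_add_left 1 _
  have hbound : (N + 1) + ((N + 1) * (L * L) + (N + 1) * L) ≤ 3 * ((N + 1) * L ^ 2) := by
    nlinarith [Nat.mul_le_mul (le_refl (N + 1)) (Nat.mul_le_mul hL1 hL1),
      Nat.mul_le_mul (le_refl (N + 1)) (Nat.mul_le_mul hL1 (le_refl L))]
  rw [ShiftedProduct.siftedSum_sieve]
  exact_mod_cast hcard.trans (Nat.add_le_add_left hbound _)

open Filter Topology

theorem tendsto_rpow_mul_log_pow_div_atTop {a : ℝ} (ha : a < 1) (k : ℕ) :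
    Tendsto (fun x : ℝ ↦ x ^ a * Real.log x ^ k / x) atTop (𝓝 0) := by
  refine (isLittleO_log_rpow_rpow_atTop k (sub_pos.2 ha)).tendsto_div_nhds_zero.congr' ?_
  filter_upwards [eventually_gt_atTop 0] with x hx
  rw [Real.rpow_natCast, Real.rpow_sub hx, Real.rpow_one]
  have := (Real.rpow_pos_of_pos hx a).ne'
  field_simp

theorem natLog_two_floor_succ_le {x : ℝ} (hx : Real.exp 1 ≤ x) :
    (Nat.log 2 (⌊x⌋₊ + 1) + 1 : ℝ) ≤ 4 * Real.log x := by
  have hx2 : 2 ≤ x := by linarith [Real.add_one_le_exp 1]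
  have hlog : 1 ≤ Real.log x := (Real.le_log_iff_exp_le (by linarith)).2 hx
  have hlog2 := Real.log_two_gt_d9
  have hfloor := Nat.floor_le (show 0 ≤ x by linarith)
  have h : (Nat.log 2 (⌊x⌋₊ + 1) : ℝ) * Real.log 2 ≤ 2 * Real.log x := by
    have h1 := Real.natLog_le_logb (⌊x⌋₊ + 1) 2
    rw [Real.logb, le_div_iff₀ (by norm_num; linarith)] at h1
    push_cast at h1
    have h2 : Real.log (⌊x⌋₊ + 1) ≤ Real.log (x ^ 2) :=
      Real.log_le_log (by positivity) (by nlinarith)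
    rw [Real.log_pow] at h2
    push_cast at h2
    linarith
  nlinarith [Nat.cast_nonneg (α := ℝ) (Nat.log 2 (⌊x⌋₊ + 1))]

theorem le_posLog_floor_rpow_div {θ x R : ℝ} (hx : 0 < x) (hxθ : 2 ≤ x ^ θ) (hR : 0 < R) :
    θ * Real.log x - Real.log (2 * R) ≤ Real.posLog (⌊x ^ θ⌋₊ / R) := by
  have hN : x ^ θ / 2 ≤ ⌊x ^ θ⌋₊ := by linarith [Nat.lt_floor_add_one (x ^ θ)]
  calc _ = Real.log (x ^ θ / 2 / R) := by
        rw [div_div, Real.log_div (by positivity) (by positivity), Real.log_rpow hx]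
    _ ≤ Real.log (⌊x ^ θ⌋₊ / R) := Real.log_le_log (by positivity) (by gcongr)
    _ ≤ _ := le_max_right _ _

open ShiftedProduct in
theorem exists_ncard_A_le {θ : ℝ} (hθ : 0 < θ) (hθ' : θ < 1 / 2) (y : ℕ) :
    ∃ c C a : ℝ, a < 1 ∧ ∀ᶠ x : ℝ in atTop, 0 < θ * Real.log x - c ∧
      ((A ∩ {n : ℕ | (n : ℝ) ≤ x}).ncard : ℝ) ≤
        (x / 6 + 1) * (162 * partialProduct y) / (θ * Real.log x - c) ^ 3 + C * x ^ a +
          96 * x ^ θ * Real.log x ^ 2 := by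
  set P := sievePrimorial y with hP
  have hP0 : (0 : ℝ) < P := by
    exact_mod_cast Nat.pos_of_ne_zero (squarefree_sievePrimorial y).ne_zero
  obtain ⟨δ, hδ0, hδ⟩ : ∃ δ : ℝ, 0 < δ ∧ θ * ((1 + δ) * 2) < 1 :=
    ⟨(1 - 2 * θ) / 2, by linarith, by nlinarith⟩
  obtain ⟨C, hC0, hC⟩ := exists_sum_boundedDivisors_le hδ0
  set R : ℝ := P * (6 * P) ^ 3 with hR
  refine ⟨Real.log (2 * R), C ^ 2, θ * ((1 + δ) * 2), hδ, ?_⟩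
  have hlogθ := Real.tendsto_log_atTop.const_mul_atTop hθ
  have hpow := tendsto_rpow_atTop hθ
  filter_upwards [eventually_ge_atTop (Real.exp 1), hpow.eventually_ge_atTop 2,
    hpow.eventually_ge_atTop y, hpow.eventually_ge_atTop P,
    hlogθ.eventually_gt_atTop (Real.log (2 * R))] with x hx hx2 hxy hxP hxR
  have hx0 : 0 < x := (Real.exp_pos 1).trans_le hx
  refine ⟨sub_pos.2 hxR, ?_⟩
  set N := ⌊x ^ θ⌋₊ with hN
  have hNx : (N : ℝ) ≤ x ^ θ := Nat.floor_le (by linarith)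
  have hN1 : 1 ≤ N := Nat.le_floor (by push_cast; linarith)
  have hset : {n : ℕ | (n : ℝ) ≤ x} = {n : ℕ | n ≤ ⌊x⌋₊} := by
    ext n
    exact (Nat.le_floor_iff hx0.le).symm
  have hG : (162 * partialProduct y)⁻¹ * (θ * Real.log x - Real.log (2 * R)) ^ 3 ≤
      (sieve (⌊x⌋₊ / 6 + 1) N).selbergSum N := by
    refine le_trans ?_ (le_selbergSum_sieve _ (Nat.le_floor hxy) (Nat.le_floor hxP))
    have := partialProduct_pos y
    have hpos := sub_pos.2 hxR
    have hle := le_posLog_floor_rpow_div (R := R) hx0 hx2 (by positivity)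
    rw [div_div]
    gcongr
  have hK : ((⌊x⌋₊ / 6 + 1 : ℕ) : ℝ) ≤ x / 6 + 1 := by
    have h1 := Nat.cast_div_le (α := ℝ) (m := ⌊x⌋₊) (n := 6)
    have h2 := Nat.floor_le hx0.le
    push_cast at h1 ⊢
    linarith
  have hmain : ((⌊x⌋₊ / 6 + 1 : ℕ) : ℝ) / (sieve (⌊x⌋₊ / 6 + 1) N).selbergSum N ≤
      (x / 6 + 1) * (162 * partialProduct y) / (θ * Real.log x - Real.log (2 * R)) ^ 3 := by
    have := partialProduct_pos y
    have hpos := pow_pos (sub_pos.2 hxR) 3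
    calc _ ≤ (x / 6 + 1) /
          ((162 * partialProduct y)⁻¹ * (θ * Real.log x - Real.log (2 * R)) ^ 3) := by gcongr
      _ = _ := by field_simp
  have herr : (∑ d ∈ (sieve (⌊x⌋₊ / 6 + 1) N).boundedDivisors N,
      (9 : ℝ) ^ ArithmeticFunction.cardDistinctFactors d) ^ 2 ≤ C ^ 2 * x ^ (θ * ((1 + δ) * 2)) := by
    calc _ ≤ (C * (x ^ θ) ^ (1 + δ)) ^ 2 := by
          refine pow_le_pow_left₀ (Finset.sum_nonneg fun _ _ ↦ by positivity)
            ((hC _ N).trans ?_) 2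
          gcongr
      _ = _ := by
          rw [mul_pow, ← Real.rpow_mul hx0.le, ← Real.rpow_mul_natCast hx0.le, mul_assoc]
          norm_num
  have hsmall : (3 * ((N + 1) * (Nat.log 2 (⌊x⌋₊ + 1) + 1) ^ 2) : ℝ) ≤
      96 * x ^ θ * Real.log x ^ 2 := by
    calc _ ≤ 3 * ((2 * x ^ θ) * (4 * Real.log x) ^ 2) := by
          gcongr
          · linarith
          · exact natLog_two_floor_succ_le hx
      _ = _ := by ring
  rw [hset]
  exact (ncard_A_le_siftedSum ⌊x⌋₊ N).trans (add_le_add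
    ((siftedSum_sieve_le _ hN1).trans (add_le_add hmain herr)) hsmall)

open ShiftedProduct in
theorem limsup_ncard_A_le_partialProduct {θ : ℝ} (hθ : 0 < θ) (hθ' : θ < 1 / 2) (y : ℕ) :
    limsup (fun x : ℝ ↦ ((A ∩ {n : ℕ | (n : ℝ) ≤ x}).ncard : ℝ) / (x / Real.log x ^ 3)) atTop ≤
      27 * partialProduct y / θ ^ 3 := by
  obtain ⟨c, C, a, ha, hev⟩ := exists_ncard_A_le hθ hθ' y
  set U : ℝ → ℝ := fun x ↦
    (1 / 6 + x⁻¹) * (162 * partialProduct y) * ((θ - c * (Real.log x)⁻¹)⁻¹) ^ 3 +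
      C * (x ^ a * Real.log x ^ 3 / x) + 96 * (x ^ θ * Real.log x ^ 5 / x) with hU
  have hlim : Tendsto U atTop (𝓝 (27 * partialProduct y / θ ^ 3)) := by
    have h1 : Tendsto (fun x : ℝ ↦ θ - c * (Real.log x)⁻¹) atTop (𝓝 (θ - c * 0)) :=
      tendsto_const_nhds.sub (Real.tendsto_log_atTop.inv_tendsto_atTop.const_mul c)
    have h2 := ((((tendsto_inv_atTop_zero (𝕜 := ℝ)).const_add (1 / 6)).mul_const
      (162 * partialProduct y)).mul ((h1.inv₀ (by simpa using hθ.ne')).pow 3)).add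
      ((tendsto_rpow_mul_log_pow_div_atTop ha 3).const_mul C)
    have h3 := h2.add ((tendsto_rpow_mul_log_pow_div_atTop (show θ < 1 by linarith) 5).const_mul 96)
    refine h3.trans_eq ?_
    congr 1
    rw [inv_pow]
    have := (pow_pos hθ 3).ne'
    simp only [mul_zero, sub_zero, add_zero]
    field_simp
    ring
  rw [← hlim.limsup_eq]
  refine limsup_le_limsup ?_ ?_ hlim.isBoundedUnder_le
  · filter_upwards [hev, eventually_gt_atTop 1] with x hx hx1
    have hlog := Real.log_pos hx1
    have hpos := hx.1
    rw [div_div_eq_mul_div]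
    calc _ ≤ ((x / 6 + 1) * (162 * partialProduct y) / (θ * Real.log x - c) ^ 3 + C * x ^ a +
          96 * x ^ θ * Real.log x ^ 2) * Real.log x ^ 3 / x := by
          gcongr
          exact hx.2
      _ = U x := by
          have hθc : θ - c * (Real.log x)⁻¹ = (θ * Real.log x - c) / Real.log x := by field_simp
          rw [hU]
          dsimp only
          rw [hθc]
          field_simp
  · refine IsCoboundedUnder.of_frequently_ge (a := 0) (Eventually.frequently ?_)
    filter_upwards [eventually_gt_atTop 1] with x hx1
    have := Real.log_pos hx1
    positivity

open ShiftedProduct in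
theorem limsup_ncard_A_le (y : ℕ) :
    limsup (fun x : ℝ ↦ ((A ∩ {n : ℕ | (n : ℝ) ≤ x}).ncard : ℝ) / (x / Real.log x ^ 3)) atTop ≤
      216 * partialProduct y := by
  have hlim : Tendsto (fun θ : ℝ ↦ 27 * partialProduct y / θ ^ 3) (𝓝[<] (1 / 2))
      (𝓝 (27 * partialProduct y / (1 / 2) ^ 3)) :=
    (tendsto_const_nhds.div (tendsto_id.pow 3) (by norm_num)).mono_left nhdsWithin_le_nhds
  refine le_trans (ge_of_tendsto hlim ?_) (le_of_eq (by ring))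
  filter_upwards [Ioo_mem_nhdsLT (show (0 : ℝ) < 1 / 2 by norm_num)] with θ hθ
  exact limsup_ncard_A_le_partialProduct hθ.1 hθ.2 y

open ShiftedProduct in
theorem exists_partialProduct_le (s : Finset {p : ℕ // p.Prime ∧ 5 ≤ p}) :
    ∃ y, partialProduct y ≤ ∏ p ∈ s, localFactor p.1 := by
  refine ⟨s.sup Subtype.val, ?_⟩
  have hmap : ∏ p ∈ s, localFactor p.1 =
      ∏ p ∈ s.map (Function.Embedding.subtype _), localFactor p := by simp
  rw [hmap]
  refine Finset.prod_le_prod_of_subset_of_le_one (fun p hp ↦ ?_) (fun p hp ↦ ?_) fun p hp _ ↦ ?_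
  · obtain ⟨q, hq, rfl⟩ := Finset.mem_map.1 hp
    exact Finset.mem_filter.2 ⟨Finset.mem_Icc.2 ⟨q.2.2, Finset.le_sup (f := Subtype.val) hq⟩, q.2.1⟩
  · exact (localFactor_pos (Finset.mem_Icc.1 (Finset.mem_filter.1 hp).1).1).le
  · exact localFactor_le_one (Finset.mem_Icc.1 (Finset.mem_filter.1 hp).1).1

theorem limsup_A_le :
    Filter.limsup
      (fun x : ℝ => ((A ∩ {n : ℕ | (n : ℝ) ≤ x}).ncard : ℝ) / (x / (Real.log x) ^ 3))
      Filter.atTop ≤ 24 * SA := by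
  set f : {p : ℕ // p.Prime ∧ 5 ≤ p} → ℝ := fun p ↦ ShiftedProduct.localFactor p.1
  suffices h : limsup (fun x : ℝ ↦ ((A ∩ {n : ℕ | (n : ℝ) ≤ x}).ncard : ℝ) /
      (x / Real.log x ^ 3)) atTop ≤ 216 * ∏' p, f p by
    refine h.trans (le_of_eq ?_)
    change 216 * ∏' p, f p = 24 * (9 * ∏' p, f p)
    ring
  by_cases hf : Multipliable f
  · refine ge_of_tendsto' (hf.hasProd.const_mul 216) fun s ↦ ?_
    obtain ⟨y, hy⟩ := exists_partialProduct_le s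
    exact (limsup_ncard_A_le y).trans (by gcongr)
  · rw [tprod_eq_one_of_not_multipliable hf]
    exact (limsup_ncard_A_le 0).trans (by gcongr; exact ShiftedProduct.partialProduct_le_one 0)
end
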